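/- arXiv:1508.06766 — 2 statements merged into one kernel-verified Lean document; each statement's English description precedes it below -/
import Mathlib

section
/- Let p>2, let u be a nonnegative classical solution of u_t−Δu=|∇u|^p in Q_T with u=0 on Γ_T, having an isolated gradient blowup point at (0,0,T) and satisfying the monotonicity condition x·u_x≤0 in Q_T. Then there exist constants C₁,C₂>0 and ρ∈(0,L) such that for all (x,y)∈ω̄_ρ∖{(0,0)} (where ω_ρ=(−ρ,ρ)×(0,ρ)) the final blowup profile satisfies u_y(x,y,T) ≥ d_p[y+C₁|x|^{2(p−1)/(p−2)}]^{−β}−C₂, where β=1/(p−1) and d_p=β^β. In particular, u_y(x,0,T) ≥ C₃|x|^{−2/(p−2)} for all 0<|x|≤ρ and some C₃>0. -/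
open Real Set Filter MeasureTheory

noncomputable section

/-- Partial derivative of `u(x,y,t)` with respect to `x`. -/
def pdx (u : ℝ → ℝ → ℝ → ℝ) (x y t : ℝ) : ℝ := deriv (fun s => u s y t) x

/-- Partial derivative with respect to `y`. -/
def pdy (u : ℝ → ℝ → ℝ → ℝ) (x y t : ℝ) : ℝ := deriv (fun s => u x s t) y

/-- Partial derivative with respect to `t`. -/
def pdt (u : ℝ → ℝ → ℝ → ℝ) (x y t : ℝ) : ℝ := deriv (fun s => u x y s) t

/-- Second partial derivative with respect to `x`. -/
def pdxx (u : ℝ → ℝ → ℝ → ℝ) (x y t : ℝ) : ℝ := deriv (fun s => pdx u s y t) x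

/-- Second partial derivative with respect to `y`. -/
def pdyy (u : ℝ → ℝ → ℝ → ℝ) (x y t : ℝ) : ℝ := deriv (fun s => pdy u x s t) y

/-- Mixed second partial derivative `u_{xy}` (first `x`, then `y`). -/
def pdxy (u : ℝ → ℝ → ℝ → ℝ) (x y t : ℝ) : ℝ := deriv (fun s => pdx u x s t) y

/-- The norm of the spatial gradient, `|∇u| = (u_x² + u_y²)^{1/2}`. -/
def gradNorm (u : ℝ → ℝ → ℝ → ℝ) (x y t : ℝ) : ℝ :=
  Real.sqrt ((pdx u x y t) ^ 2 + (pdy u x y t) ^ 2)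

/-- `C^{2,1}`-type regularity of `u` at the point `(x,y,t)`: twice (continuously)
differentiable in the space variables and once in time. -/
def C21At (u : ℝ → ℝ → ℝ → ℝ) (x y t : ℝ) : Prop :=
  DifferentiableAt ℝ (fun s => u s y t) x ∧
  DifferentiableAt ℝ (fun s => u x s t) y ∧
  DifferentiableAt ℝ (fun s => u x y s) t ∧
  DifferentiableAt ℝ (fun s => pdx u s y t) x ∧
  DifferentiableAt ℝ (fun s => pdy u x s t) y ∧
  DifferentiableAt ℝ (fun s => pdx u x s t) y ∧
  ContinuousAt (fun q : ℝ × ℝ × ℝ => u q.1 q.2.1 q.2.2) (x, y, t) ∧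
  ContinuousAt (fun q : ℝ × ℝ × ℝ => pdx u q.1 q.2.1 q.2.2) (x, y, t) ∧
  ContinuousAt (fun q : ℝ × ℝ × ℝ => pdy u q.1 q.2.1 q.2.2) (x, y, t) ∧
  ContinuousAt (fun q : ℝ × ℝ × ℝ => pdt u q.1 q.2.1 q.2.2) (x, y, t) ∧
  ContinuousAt (fun q : ℝ × ℝ × ℝ => pdxx u q.1 q.2.1 q.2.2) (x, y, t) ∧
  ContinuousAt (fun q : ℝ × ℝ × ℝ => pdyy u q.1 q.2.1 q.2.2) (x, y, t) ∧
  ContinuousAt (fun q : ℝ × ℝ × ℝ => pdxy u q.1 q.2.1 q.2.2) (x, y, t)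

/-- `u` is a nonnegative classical solution of `u_t - Δu = |∇u|^p` in
`Q_T = ω × (0,T)`, `ω = (-L,L) × (0,L)`, with `u = 0` on `Γ_T = (-L,L) × {0} × (0,T)`. -/
structure ClassicalSolution (p L T : ℝ) (u : ℝ → ℝ → ℝ → ℝ) : Prop where
  nonneg : ∀ ⦃x y t : ℝ⦄, |x| ≤ L → y ∈ Icc (0:ℝ) L → t ∈ Ioo 0 T → 0 ≤ u x y t
  smooth : ∀ ⦃x y t : ℝ⦄, |x| ≤ L → y ∈ Icc (0:ℝ) L → t ∈ Ioo 0 T → C21At u x y t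
  pde : ∀ ⦃x y t : ℝ⦄, |x| < L → y ∈ Ioo (0:ℝ) L → t ∈ Ioo 0 T →
    pdt u x y t - (pdxx u x y t + pdyy u x y t) = gradNorm u x y t ^ p
  bc : ∀ ⦃x t : ℝ⦄, |x| < L → t ∈ Ioo 0 T → u x 0 t = 0

/-- `u` has an isolated gradient blow-up point at `(0,0,T)`:
`limsup |∇u| = ∞` at `(0,0,T)` while `∇u` stays bounded on `K × (0,T)` for every
compact `K ⊆ ω̄ \ {(0,0)}`. -/
structure IsolatedGBU (L T : ℝ) (u : ℝ → ℝ → ℝ → ℝ) : Prop where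
  blowup : ∀ M : ℝ, ∀ δ > (0:ℝ), ∃ x y t : ℝ, |x| ≤ L ∧ y ∈ Icc (0:ℝ) L ∧
    t ∈ Ioo 0 T ∧ |x| < δ ∧ |y| < δ ∧ T - δ < t ∧ M < gradNorm u x y t
  bounded : ∀ K : Set (ℝ × ℝ), IsCompact K →
    K ⊆ (Icc (-L) L ×ˢ Icc (0:ℝ) L) \ {((0:ℝ), (0:ℝ))} →
    ∃ M : ℝ, ∀ q ∈ K, ∀ t ∈ Ioo (0:ℝ) T, gradNorm u q.1 q.2 t ≤ M

/-- `u` extends as a `C^{2,1}` function to `(ω̄' × [T/2,T]) \ {(0,0,T)}`,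
`ω' = (-L/2,L/2) × (0,L/2)`; values and derivatives at `t = T` refer to this extension. -/
def ExtC21 (L T : ℝ) (u : ℝ → ℝ → ℝ → ℝ) : Prop :=
  ∀ ⦃x y t : ℝ⦄, |x| ≤ L / 2 → y ∈ Icc (0:ℝ) (L / 2) → t ∈ Icc (T / 2) T →
    ¬(x = 0 ∧ y = 0 ∧ t = T) → C21At u x y t

/-- The monotonicity condition `x·u_x ≤ 0` in `Q_T`. -/
def MonCond (L T : ℝ) (u : ℝ → ℝ → ℝ → ℝ) : Prop :=
  ∀ ⦃x y t : ℝ⦄, |x| < L → y ∈ Ioo (0:ℝ) L → t ∈ Ioo 0 T → x * pdx u x y t ≤ 0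

/-! ### Calculus tests -/

theorem sd_test (g g' : ℝ → ℝ) (g'' x : ℝ) (h1 : ∀ᶠ s in nhds x, HasDerivAt g (g' s) s)
    (h2 : HasDerivAt g' g'' x) (hmin : IsLocalMin g x) : g' x = 0 ∧ 0 ≤ g'' := by
  have hx := h1.self_of_nhds
  have h0 : g' x = 0 := hmin.hasDerivAt_eq_zero hx
  refine ⟨h0, ?_⟩
  by_contra hneg
  push Not at hneg
  have e1 : deriv g =ᶠ[nhds x] g' := h1.mono (fun s hs => hs.deriv)
  have e2 : deriv (deriv g) x = g'' := by rw [e1.deriv_eq]; exact h2.deriv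
  have hmax : IsLocalMax g x :=
    isLocalMax_of_deriv_deriv_neg (by rw [e2]; exact hneg) (by rw [hx.deriv]; exact h0)
      hx.continuousAt
  have hc : g =ᶠ[nhds x] fun _ => g x := by
    filter_upwards [hmin, hmax] with s hs1 hs2
    exact le_antisymm hs2 hs1
  have e3 : deriv g =ᶠ[nhds x] fun _ => 0 := by
    have := hc.deriv
    simpa using this
  have e4 : deriv (deriv g) x = 0 := by rw [e3.deriv_eq]; simp
  rw [e2] at e4
  linarith

theorem left_test (g : ℝ → ℝ) (g' t0 t : ℝ) (h : HasDerivAt g g' t) (ht : t0 < t)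
    (hm : ∀ s ∈ Icc t0 t, g t ≤ g s) : g' ≤ 0 := by
  have h1 := (hasDerivAt_iff_tendsto_slope.1 h).mono_left
    (nhdsWithin_mono t (fun s (hs : s < t) => ne_of_lt hs) : nhdsWithin t (Iio t) ≤ _)
  refine le_of_tendsto h1 ?_
  filter_upwards [Ioo_mem_nhdsLT ht] with s hs
  rw [slope_def_field]
  apply div_nonpos_of_nonneg_of_nonpos
  · linarith [hm s ⟨hs.1.le, hs.2.le⟩]
  · linarith [hs.2]

theorem right_test (g : ℝ → ℝ) (g' t t1 : ℝ) (h : HasDerivAt g g' t) (ht : t < t1)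
    (hm : ∀ s ∈ Ioo t t1, g t ≤ g s) : 0 ≤ g' := by
  have h1 := (hasDerivAt_iff_tendsto_slope.1 h).mono_left
    (nhdsWithin_mono t (fun s (hs : t < s) => (ne_of_lt hs).symm) : nhdsWithin t (Ioi t) ≤ _)
  refine ge_of_tendsto h1 ?_
  filter_upwards [Ioo_mem_nhdsGT ht] with s hs
  rw [slope_def_field]
  apply div_nonneg
  · linarith [hm s hs]
  · linarith [hs.1]

/-- Parabolic minimum principle. -/
theorem comp0 (a b t0 t1 : ℝ) (W Wx Wy Wt Wxx Wyy : ℝ → ℝ → ℝ → ℝ)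
    (hcont : ∀ x y t, |x| ≤ a → y ∈ Icc 0 b → t ∈ Icc t0 t1 →
      ContinuousAt (fun q : ℝ × ℝ × ℝ => W q.1 q.2.1 q.2.2) (x, y, t))
    (hbd : ∀ x y t, |x| ≤ a → y ∈ Icc 0 b → t ∈ Icc t0 t1 →
      (|x| = a ∨ y = 0 ∨ y = b ∨ t = t0) → 0 ≤ W x y t)
    (hx : ∀ x y t, |x| < a → y ∈ Ioo 0 b → t ∈ Ioc t0 t1 →
      HasDerivAt (fun s => W s y t) (Wx x y t) x)
    (hy : ∀ x y t, |x| < a → y ∈ Ioo 0 b → t ∈ Ioc t0 t1 →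
      HasDerivAt (fun s => W x s t) (Wy x y t) y)
    (ht : ∀ x y t, |x| < a → y ∈ Ioo 0 b → t ∈ Ioc t0 t1 →
      HasDerivAt (fun s => W x y s) (Wt x y t) t)
    (hxx : ∀ x y t, |x| < a → y ∈ Ioo 0 b → t ∈ Ioc t0 t1 →
      HasDerivAt (fun s => Wx s y t) (Wxx x y t) x)
    (hyy : ∀ x y t, |x| < a → y ∈ Ioo 0 b → t ∈ Ioc t0 t1 →
      HasDerivAt (fun s => Wy x s t) (Wyy x y t) y)
    (hd : ∀ x y t, |x| < a → y ∈ Ioo 0 b → t ∈ Ioc t0 t1 → W x y t < 0 →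
      Wx x y t = 0 → Wy x y t = 0 → 0 ≤ Wt x y t - Wxx x y t - Wyy x y t) :
    ∀ x y t, |x| ≤ a → y ∈ Icc 0 b → t ∈ Icc t0 t1 → 0 ≤ W x y t := by
  intro x0 y0 s0 hx0 hy0 hs0
  by_contra hneg
  push Not at hneg
  set D : Set (ℝ × ℝ × ℝ) := Icc (-a) a ×ˢ (Icc 0 b ×ˢ Icc t0 t1) with hD
  have hDc : IsCompact D := isCompact_Icc.prod (isCompact_Icc.prod isCompact_Icc)
  obtain ⟨ε, hε, hε2⟩ : ∃ ε > 0, W x0 y0 s0 + ε * (s0 - t0) < 0 := by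
    have h1 : 0 ≤ s0 - t0 := by linarith [hs0.1]
    refine ⟨-W x0 y0 s0 / (2 * (s0 - t0 + 1)), by apply div_pos <;> linarith, ?_⟩
    have : -W x0 y0 s0 / (2 * (s0 - t0 + 1)) * (s0 - t0) ≤ -W x0 y0 s0 / 2 := by
      rw [div_mul_eq_mul_div, div_le_div_iff₀ (by linarith) (by norm_num)]
      nlinarith
    linarith
  set Z : ℝ × ℝ × ℝ → ℝ := fun q => W q.1 q.2.1 q.2.2 + ε * (q.2.2 - t0) with hZ
  have hZc : ContinuousOn Z D := by
    rintro ⟨x, y, t⟩ ⟨h1, h2, h3⟩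
    have := hcont x y t (abs_le.2 h1) h2 h3
    apply ContinuousAt.continuousWithinAt
    exact this.add (by fun_prop)
  obtain ⟨⟨x, y, t⟩, ⟨h1, h2, h3⟩, hmin⟩ := hDc.exists_isMinOn
    ⟨(x0, y0, s0), abs_le.1 hx0, hy0, hs0⟩ hZc
  have hm : ∀ x' y' t', |x'| ≤ a → y' ∈ Icc 0 b → t' ∈ Icc t0 t1 →
      W x y t + ε * (t - t0) ≤ W x' y' t' + ε * (t' - t0) := by
    intro x' y' t' a1 a2 a3
    exact hmin (show (x', y', t') ∈ D from ⟨abs_le.1 a1, a2, a3⟩)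
  have hx1 : |x| ≤ a := abs_le.2 h1
  have hlt : W x y t + ε * (t - t0) < 0 := lt_of_le_of_lt (hm x0 y0 s0 hx0 hy0 hs0) hε2
  have hWlt : W x y t < 0 := by
    have : 0 ≤ ε * (t - t0) := mul_nonneg hε.le (by linarith [h3.1])
    linarith
  have hnb : ¬ (|x| = a ∨ y = 0 ∨ y = b ∨ t = t0) := fun h =>
    absurd (hbd x y t hx1 h2 h3 h) (by linarith)
  push Not at hnb
  obtain ⟨n1, n2, n3, n4⟩ := hnb
  have i1 : |x| < a := lt_of_le_of_ne hx1 n1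
  have i2 : y ∈ Ioo 0 b := ⟨lt_of_le_of_ne h2.1 (Ne.symm n2), lt_of_le_of_ne h2.2 n3⟩
  have i3 : t ∈ Ioc t0 t1 := ⟨lt_of_le_of_ne h3.1 (Ne.symm n4), h3.2⟩
  have ex : ∀ᶠ s in nhds x, |s| < a := continuous_abs.continuousAt.eventually_lt continuousAt_const i1
  have ey : ∀ᶠ s in nhds y, s ∈ Ioo 0 b := Ioo_mem_nhds i2.1 i2.2
  have r1 := sd_test (fun s => W s y t) (fun s => Wx s y t) (Wxx x y t) x
    (ex.mono fun s hs => hx s y t hs i2 i3) (hxx x y t i1 i2 i3)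
    (ex.mono fun s hs => by
      have := hm s y t hs.le h2 h3
      simp only; linarith)
  have r2 := sd_test (fun s => W x s t) (fun s => Wy x s t) (Wyy x y t) y
    (ey.mono fun s hs => hy x s t i1 hs i3) (hyy x y t i1 i2 i3)
    (ey.mono fun s hs => by
      have := hm x s t hx1 ⟨hs.1.le, hs.2.le⟩ h3
      simp only; linarith)
  have r3 := left_test (fun s => W x y s + ε * (s - t0)) (Wt x y t + ε * 1) t0 t
    ((ht x y t i1 i2 i3).add (((hasDerivAt_id t).sub_const t0).const_mul ε)) i3.1
    (fun s hs => hm x y s hx1 h2 ⟨hs.1, hs.2.trans h3.2⟩)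
  have := hd x y t i1 i2 i3 hWlt r1.1 r2.1
  linarith [r1.2, r2.2]

theorem rpow_tangent (q G G' : ℝ) (hq : 1 < q) (hG : 0 ≤ G) (hG' : 0 ≤ G') :
    G ^ q + q * G ^ (q - 1) * (G' - G) ≤ G' ^ q := by
  rcases hG.eq_or_lt with h | h
  · subst h
    rw [Real.zero_rpow (by linarith), Real.zero_rpow (by linarith)]
    simpa using Real.rpow_nonneg hG' q
  · have hb := one_add_mul_self_le_rpow_one_add (s := G' / G - 1)
      (by have := div_nonneg hG' hG; linarith) hq.le
    have e1 : (1 + (G' / G - 1)) ^ q = G' ^ q / G ^ q := by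
      rw [add_sub_cancel, Real.div_rpow hG' hG]
    rw [e1] at hb
    have hp : 0 < G ^ q := Real.rpow_pos_of_pos h q
    rw [le_div_iff₀ hp] at hb
    have e2 : G ^ (q - 1) = G ^ q / G := by rw [Real.rpow_sub h, Real.rpow_one]
    rw [e2]
    calc _ = (1 + q * (G' / G - 1)) * G ^ q := by field_simp
      _ ≤ _ := hb

theorem grad_ineq (p w v b c : ℝ) (hp : 2 < p) :
    (√(w ^ 2 + v ^ 2)) ^ p + p * (w ^ 2 + v ^ 2) ^ (p / 2 - 1) * (w * b + v * c) ≤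
      (√((w + b) ^ 2 + (v + c) ^ 2)) ^ p := by
  have h1 : 0 ≤ w ^ 2 + v ^ 2 := by positivity
  have h2 : 0 ≤ (w + b) ^ 2 + (v + c) ^ 2 := by positivity
  have key := rpow_tangent (p / 2) _ _ (by linarith) h1 h2
  have e : ∀ g : ℝ, 0 ≤ g → (√g) ^ p = g ^ (p / 2) := by
    intro g hg
    rw [Real.sqrt_eq_rpow, ← Real.rpow_mul hg]; congr 1; ring
  rw [e _ h1, e _ h2]
  refine le_trans ?_ key
  have h3 : 0 ≤ (w ^ 2 + v ^ 2) ^ (p / 2 - 1) := Real.rpow_nonneg h1 _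
  have h4 : 0 ≤ p * (w ^ 2 + v ^ 2) ^ (p / 2 - 1) * (b ^ 2 + c ^ 2) := by positivity
  nlinarith

/-! ### Regularity helpers -/

theorem C21At.dx {u : ℝ → ℝ → ℝ → ℝ} {x y t : ℝ} (h : C21At u x y t) :
    HasDerivAt (fun s => u s y t) (pdx u x y t) x := h.1.hasDerivAt
theorem C21At.dy {u : ℝ → ℝ → ℝ → ℝ} {x y t : ℝ} (h : C21At u x y t) :
    HasDerivAt (fun s => u x s t) (pdy u x y t) y := h.2.1.hasDerivAt
theorem C21At.dt {u : ℝ → ℝ → ℝ → ℝ} {x y t : ℝ} (h : C21At u x y t) :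
    HasDerivAt (fun s => u x y s) (pdt u x y t) t := h.2.2.1.hasDerivAt
theorem C21At.dxx {u : ℝ → ℝ → ℝ → ℝ} {x y t : ℝ} (h : C21At u x y t) :
    HasDerivAt (fun s => pdx u s y t) (pdxx u x y t) x := h.2.2.2.1.hasDerivAt
theorem C21At.dyy {u : ℝ → ℝ → ℝ → ℝ} {x y t : ℝ} (h : C21At u x y t) :
    HasDerivAt (fun s => pdy u x s t) (pdyy u x y t) y := h.2.2.2.2.1.hasDerivAt

theorem C21At.shift {u : ℝ → ℝ → ℝ → ℝ} {x y t : ℝ} (a b c : ℝ)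
    (h : C21At u (x + a) (y + b) (t + c)) :
    ContinuousAt (fun q : ℝ × ℝ × ℝ => u (q.1 + a) (q.2.1 + b) (q.2.2 + c)) (x, y, t) := by
  have h1 := h.2.2.2.2.2.2.1
  have h2 : ContinuousAt (fun q : ℝ × ℝ × ℝ => ((q.1 + a, q.2.1 + b, q.2.2 + c) : ℝ × ℝ × ℝ))
      (x, y, t) := by fun_prop
  exact ContinuousAt.comp (f := fun q : ℝ × ℝ × ℝ => ((q.1 + a, q.2.1 + b, q.2.2 + c) : ℝ × ℝ × ℝ))
    (g := fun q : ℝ × ℝ × ℝ => u q.1 q.2.1 q.2.2) h1 h2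

theorem C21At.cont {u : ℝ → ℝ → ℝ → ℝ} {x y t : ℝ} (h : C21At u x y t) :
    ContinuousAt (fun q : ℝ × ℝ × ℝ => u q.1 q.2.1 q.2.2) (x, y, t) := h.2.2.2.2.2.2.1

theorem bound_away {L T : ℝ} {u : ℝ → ℝ → ℝ → ℝ} (hext : ExtC21 L T u) (δ : ℝ) (hδ : 0 < δ) :
    ∃ M > 0, ∀ x y t, |x| ≤ L / 2 → y ∈ Icc 0 (L / 2) → t ∈ Icc (T / 2) T →
      δ ≤ |x| + y + (T - t) →
      |pdx u x y t| ≤ M ∧ |pdy u x y t| ≤ M ∧ |pdt u x y t| ≤ M ∧ |pdxx u x y t| ≤ M ∧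
        |pdyy u x y t| ≤ M := by
  set D : Set (ℝ × ℝ × ℝ) := (Icc (-(L / 2)) (L / 2) ×ˢ (Icc 0 (L / 2) ×ˢ Icc (T / 2) T)) ∩
    {q | δ ≤ |q.1| + q.2.1 + (T - q.2.2)} with hD
  have hDc : IsCompact D :=
    (isCompact_Icc.prod (isCompact_Icc.prod isCompact_Icc)).inter_right
      (isClosed_le continuous_const (by fun_prop))
  have hreg : ∀ q ∈ D, C21At u q.1 q.2.1 q.2.2 := by
    rintro ⟨x, y, t⟩ ⟨⟨h1, h2, h3⟩, h4⟩
    refine hext (abs_le.2 h1) h2 h3 ?_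
    rintro ⟨rfl, rfl, rfl⟩
    simp at h4
    linarith
  have bd : ∀ g : ℝ × ℝ × ℝ → ℝ, (∀ q ∈ D, ContinuousAt g q) → ∃ M, ∀ q ∈ D, |g q| ≤ M := by
    intro g hg
    obtain ⟨M, hM⟩ := hDc.exists_bound_of_continuousOn
      (fun q hq => (hg q hq).continuousWithinAt)
    exact ⟨M, hM⟩
  obtain ⟨M1, h1⟩ := bd _ (fun q hq => (hreg q hq).2.2.2.2.2.2.2.1)
  obtain ⟨M2, h2⟩ := bd _ (fun q hq => (hreg q hq).2.2.2.2.2.2.2.2.1)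
  obtain ⟨M3, h3⟩ := bd _ (fun q hq => (hreg q hq).2.2.2.2.2.2.2.2.2.1)
  obtain ⟨M4, h4⟩ := bd _ (fun q hq => (hreg q hq).2.2.2.2.2.2.2.2.2.2.1)
  obtain ⟨M5, h5⟩ := bd _ (fun q hq => (hreg q hq).2.2.2.2.2.2.2.2.2.2.2.1)
  refine ⟨|M1| + |M2| + |M3| + |M4| + |M5| + 1, by positivity, ?_⟩
  intro x y t a1 a2 a3 a4
  have hq : (x, y, t) ∈ D := ⟨⟨abs_le.1 a1, a2, a3⟩, a4⟩
  have b1 := h1 _ hq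
  have b2 := h2 _ hq
  have b3 := h3 _ hq
  have b4 := h4 _ hq
  have b5 := h5 _ hq
  simp only at b1 b2 b3 b4 b5
  have c1 := le_abs_self M1
  have c2 := le_abs_self M2
  have c3 := le_abs_self M3
  have c4 := le_abs_self M4
  have c5 := le_abs_self M5
  have d1 := abs_nonneg M1
  have d2 := abs_nonneg M2
  have d3 := abs_nonneg M3
  have d4 := abs_nonneg M4
  have d5 := abs_nonneg M5
  refine ⟨?_, ?_, ?_, ?_, ?_⟩ <;> linarith

/-- two-point estimate from a derivative bound -/
theorem mvt_abs (g g' : ℝ → ℝ) (a b M : ℝ) (hab : a ≤ b)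
    (hg : ∀ s ∈ Icc a b, HasDerivAt g (g' s) s) (hM : ∀ s ∈ Icc a b, |g' s| ≤ M) :
    |g b - g a| ≤ M * (b - a) := by
  have := norm_image_sub_le_of_norm_deriv_le_segment' (f := g) (f' := g') (C := M) (a := a) (b := b)
    (fun s hs => (hg s hs).hasDerivWithinAt) (fun s hs => hM s ⟨hs.1, hs.2.le⟩) b ⟨hab, le_rfl⟩
  exact this

theorem mvt_lower (g g' : ℝ → ℝ) (a b m : ℝ) (hab : a ≤ b)
    (hg : ∀ s ∈ Icc a b, HasDerivAt g (g' s) s) (hm : ∀ s ∈ Ioo a b, m ≤ g' s) :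
    m * (b - a) ≤ g b - g a := by
  have hc : ContinuousOn g (Icc a b) := fun s hs => (hg s hs).continuousAt.continuousWithinAt
  refine (convex_Icc a b).mul_sub_le_image_sub_of_le_deriv hc ?_ ?_ a ⟨le_rfl, hab⟩ b ⟨hab, le_rfl⟩
    hab
  · rw [interior_Icc]
    exact fun s hs => (hg s ⟨hs.1.le, hs.2.le⟩).differentiableAt.differentiableWithinAt
  · rw [interior_Icc]
    intro s hs
    rw [(hg s ⟨hs.1.le, hs.2.le⟩).deriv]
    exact hm s hs

theorem mvt_upper (g g' : ℝ → ℝ) (a b m : ℝ) (hab : a ≤ b)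
    (hg : ∀ s ∈ Icc a b, HasDerivAt g (g' s) s) (hm : ∀ s ∈ Ioo a b, g' s ≤ m) :
    g b - g a ≤ m * (b - a) := by
  have := mvt_lower (fun s => -g s) (fun s => -g' s) a b (-m) hab (fun s hs => (hg s hs).neg)
    (fun s hs => neg_le_neg (hm s hs))
  linarith

/-- second difference -/
theorem second_diff (g g' g'' : ℝ → ℝ) (x h M : ℝ) (hh : 0 ≤ h)
    (hg : ∀ s ∈ Icc (x - h) (x + h), HasDerivAt g (g' s) s)
    (hg' : ∀ s ∈ Icc (x - h) (x + h), HasDerivAt g' (g'' s) s)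
    (hM : ∀ s ∈ Icc (x - h) (x + h), -M ≤ g'' s) :
    0 ≤ g (x + h) + g (x - h) - 2 * g x + M * h ^ 2 := by
  -- `g' (x + s) - g' (x - s) ≥ -2 M s`
  have h1 : ∀ s ∈ Icc 0 h, -M * (2 * s) ≤ g' (x + s) - g' (x - s) := by
    intro s hs
    have := mvt_lower g' g'' (x - s) (x + s) (-M) (by linarith [hs.1])
      (fun z hz => hg' z ⟨by linarith [hz.1, hs.2], by linarith [hz.2, hs.2]⟩)
      (fun z hz => hM z ⟨by linarith [hz.1, hs.2], by linarith [hz.2, hs.2]⟩)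
    linarith
  have h2 := mvt_lower (fun s => g (x + s) + g (x - s) + M * s ^ 2)
    (fun s => g' (x + s) + -g' (x - s) + M * (2 * s)) 0 h 0 hh
    (fun s hs => by
      have a1 : HasDerivAt (fun s => g (x + s)) (g' (x + s)) s :=
        (hg (x + s) ⟨by linarith [hs.1], by linarith [hs.2]⟩).comp_const_add x s
      have a2 : HasDerivAt (fun s => g (x - s)) (-g' (x - s)) s :=
        (hg (x - s) ⟨by linarith [hs.2], by linarith [hs.1]⟩).comp_const_sub x s
      have a3 : HasDerivAt (fun s : ℝ => M * s ^ 2) (M * (2 * s)) s := by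
        simpa using (hasDerivAt_pow 2 s).const_mul M
      exact (a1.add a2).add a3)
    (fun s hs => by
      have := h1 s ⟨hs.1.le, hs.2.le⟩
      linarith)
  simp only [add_zero, sub_zero, zero_mul] at h2
  linarith [h2]

/-! ### Bounds on `u_t` and `u_xx` -/

theorem time_bound {p L T : ℝ} (hL : 0 < L) (hT : 0 < T) {u : ℝ → ℝ → ℝ → ℝ}
    (hsol : ClassicalSolution p L T u) (hext : ExtC21 L T u) :
    ∃ M > 0, ∀ x y t, |x| ≤ L / 4 → y ∈ Icc 0 (L / 4) → t ∈ Ico (T / 2) T →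
      |pdt u x y t| ≤ M := by
  obtain ⟨M, hM, hb⟩ := bound_away hext (min (L / 8) (T / 8)) (by positivity)
  refine ⟨M, hM, ?_⟩
  have hδ1 := min_le_left (L / 8) (T / 8)
  have hδ2 := min_le_right (L / 8) (T / 8)
  have key : ∀ σ : ℝ, |σ| = 1 → ∀ t1 ∈ Ico (T / 2) T, ∀ h, 0 < h → h < T / 4 → t1 + h < T →
      ∀ x y t, |x| ≤ L / 4 → y ∈ Icc 0 (L / 4) → t ∈ Icc (T / 2) t1 →
        0 ≤ σ * (u x y (t + h) - u x y t) + M * h := by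
    intro σ hσ t1 ht1 h h0 h1 h2
    have R1 : ∀ x y t, |x| ≤ L / 4 → y ∈ Icc 0 (L / 4) → t ∈ Icc (T / 2) t1 → C21At u x y t :=
      fun x y t a b c => hsol.smooth (by linarith) ⟨b.1, by linarith [b.2]⟩
        ⟨by linarith [c.1], by linarith [c.2, ht1.2]⟩
    have R2 : ∀ x y t, |x| ≤ L / 4 → y ∈ Icc 0 (L / 4) → t ∈ Icc (T / 2) t1 →
      C21At u x y (t + h) :=
      fun x y t a b c => hsol.smooth (by linarith) ⟨b.1, by linarith [b.2]⟩
        ⟨by linarith [c.1], by linarith [c.2, ht1.2]⟩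
    apply comp0 (L / 4) (L / 4) (T / 2) t1
      (fun x y t => σ * (u x y (t + h) - u x y t) + M * h)
      (fun x y t => σ * (pdx u x y (t + h) - pdx u x y t))
      (fun x y t => σ * (pdy u x y (t + h) - pdy u x y t))
      (fun x y t => σ * (pdt u x y (t + h) - pdt u x y t))
      (fun x y t => σ * (pdxx u x y (t + h) - pdxx u x y t))
      (fun x y t => σ * (pdyy u x y (t + h) - pdyy u x y t))
    · intro x y t a b c
      have c1 := C21At.shift (u := u) (x := x) (y := y) (t := t) 0 0 h (by
        simpa using R2 x y t a b c)
      simp only [add_zero] at c1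
      have c2 := (R1 x y t a b c).cont
      exact ((c1.sub c2).const_mul σ).add continuousAt_const
    · intro x y t a b c d
      by_cases hy0 : y = 0
      · rw [hy0, hsol.bc (by linarith) ⟨by linarith [c.1], by linarith [c.2, ht1.2]⟩,
          hsol.bc (by linarith) ⟨by linarith [c.1], by linarith [c.2, ht1.2]⟩]
        simp; positivity
      · have hm := mvt_abs (fun s => u x y s) (fun s => pdt u x y s) t (t + h) M (by linarith)
          (fun s hs => (hsol.smooth (by linarith) ⟨b.1, by linarith [b.2]⟩
            ⟨by linarith [c.1, hs.1], by linarith [c.2, hs.2]⟩ : C21At u x y s).dt)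
          (fun s hs => by
            refine (hb x y s (by linarith) ⟨b.1, by linarith [b.2]⟩
              ⟨by linarith [c.1, hs.1], by linarith [c.2, hs.2]⟩ ?_).2.2.1
            have q1 := abs_nonneg x
            have q2 := b.1
            have q3 : s < T := by linarith [hs.2, c.2]
            rcases d with d | d | d | d
            · linarith
            · exact absurd d hy0
            · linarith
            · linarith [hs.2])
        have : |σ * (u x y (t + h) - u x y t)| ≤ M * h := by
          rw [abs_mul, hσ, one_mul]; convert hm using 2; ring
        linarith [neg_abs_le (σ * (u x y (t + h) - u x y t))]
    · intro x y t a b c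
      exact (((R2 x y t a.le (Ioo_subset_Icc_self b) (Ioc_subset_Icc_self c)).dx.sub
        (R1 x y t a.le (Ioo_subset_Icc_self b) (Ioc_subset_Icc_self c)).dx).const_mul σ).add_const _
    · intro x y t a b c
      exact (((R2 x y t a.le (Ioo_subset_Icc_self b) (Ioc_subset_Icc_self c)).dy.sub
        (R1 x y t a.le (Ioo_subset_Icc_self b) (Ioc_subset_Icc_self c)).dy).const_mul σ).add_const _
    · intro x y t a b c
      have e1 := (R2 x y t a.le (Ioo_subset_Icc_self b) (Ioc_subset_Icc_self c)).dt.comp_add_const t h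
      exact ((e1.sub
        (R1 x y t a.le (Ioo_subset_Icc_self b) (Ioc_subset_Icc_self c)).dt).const_mul σ).add_const _
    · intro x y t a b c
      exact ((R2 x y t a.le (Ioo_subset_Icc_self b) (Ioc_subset_Icc_self c)).dxx.sub
        (R1 x y t a.le (Ioo_subset_Icc_self b) (Ioc_subset_Icc_self c)).dxx).const_mul σ
    · intro x y t a b c
      exact ((R2 x y t a.le (Ioo_subset_Icc_self b) (Ioc_subset_Icc_self c)).dyy.sub
        (R1 x y t a.le (Ioo_subset_Icc_self b) (Ioc_subset_Icc_self c)).dyy).const_mul σ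
    · intro x y t a b c _ d1 d2
      have hσ0 : σ ≠ 0 := by rintro rfl; simp at hσ
      have e1 : pdx u x y (t + h) = pdx u x y t := by
        have := (mul_eq_zero.1 d1).resolve_left hσ0; linarith
      have e2 : pdy u x y (t + h) = pdy u x y t := by
        have := (mul_eq_zero.1 d2).resolve_left hσ0; linarith
      have p1 := hsol.pde (x := x) (y := y) (t := t) (by linarith) ⟨b.1, by linarith [b.2]⟩
        ⟨by linarith [c.1], by linarith [c.2, ht1.2]⟩
      have p2 := hsol.pde (x := x) (y := y) (t := t + h) (by linarith) ⟨b.1, by linarith [b.2]⟩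
        ⟨by linarith [c.1], by linarith [c.2, ht1.2]⟩
      have e3 : gradNorm u x y (t + h) = gradNorm u x y t := by
        unfold gradNorm; rw [e1, e2]
      rw [e3] at p2
      have : pdt u x y (t + h) - pdt u x y t - (pdxx u x y (t + h) - pdxx u x y t) -
        (pdyy u x y (t + h) - pdyy u x y t) = 0 := by linarith
      have : σ * (pdt u x y (t + h) - pdt u x y t) - σ * (pdxx u x y (t + h) - pdxx u x y t) -
        σ * (pdyy u x y (t + h) - pdyy u x y t) = 0 := by
        rw [← mul_sub, ← mul_sub, this, mul_zero]
      rw [this]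
  intro x y t a b c
  have hreg : C21At u x y t := hsol.smooth (by linarith) ⟨b.1, by linarith [b.2]⟩
    ⟨by linarith [c.1], c.2⟩
  have fin : ∀ σ : ℝ, |σ| = 1 → 0 ≤ σ * pdt u x y t + M * 1 := by
    intro σ hσ
    refine right_test (fun s => σ * (u x y s) + M * s) _ t (t + min (T / 4) (T - t))
      ((hreg.dt.const_mul σ).add ((hasDerivAt_id t).const_mul M)) ?_ ?_
    · have : 0 < min (T / 4) (T - t) := lt_min (by positivity) (by linarith [c.2])
      linarith
    · intro s hs
      have m1 := min_le_left (T / 4) (T - t)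
      have m2 := min_le_right (T / 4) (T - t)
      have := key σ hσ t c (s - t) (by linarith [hs.1]) (by linarith [hs.2]) (by linarith [hs.2])
        x y t a b ⟨c.1, le_rfl⟩
      rw [add_sub_cancel] at this
      linarith
  rw [abs_le]
  constructor
  · have := fin 1 (by simp); linarith
  · have := fin (-1) (by simp); linarith

theorem xx_bound {p L T : ℝ} (hp : 2 < p) (hL : 0 < L) (hT : 0 < T) {u : ℝ → ℝ → ℝ → ℝ}
    (hsol : ClassicalSolution p L T u) (hext : ExtC21 L T u) :
    ∃ M > 0, ∀ x y t, |x| ≤ L / 4 → y ∈ Icc 0 (L / 4) → t ∈ Ico (T / 2) T →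
      -M ≤ pdxx u x y t := by
  obtain ⟨M, hM, hb⟩ := bound_away hext (min (L / 8) (T / 8)) (by positivity)
  refine ⟨M, hM, ?_⟩
  have hδ1 := min_le_left (L / 8) (T / 8)
  have hδ2 := min_le_right (L / 8) (T / 8)
  have key : ∀ t1 ∈ Ico (T / 2) T, ∀ h, 0 ≤ h → h < L / 8 →
      ∀ x y t, |x| ≤ L / 4 → y ∈ Icc 0 (L / 4) → t ∈ Icc (T / 2) t1 →
        0 ≤ u (x + h) y t + u (x - h) y t - 2 * u x y t + M * h ^ 2 := by
    intro t1 ht1 h h0 h1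
    have R : ∀ x y t, |x| ≤ 3 * L / 8 → y ∈ Icc 0 (L / 4) → t ∈ Icc (T / 2) t1 → C21At u x y t :=
      fun x y t a b c => hsol.smooth (by linarith) ⟨b.1, by linarith [b.2]⟩
        ⟨by linarith [c.1], by linarith [c.2, ht1.2]⟩
    have A1 : ∀ x : ℝ, |x| ≤ L / 4 → |x + h| ≤ 3 * L / 8 := fun x a => by
      rw [abs_le] at *; constructor <;> linarith
    have A2 : ∀ x : ℝ, |x| ≤ L / 4 → |x - h| ≤ 3 * L / 8 := fun x a => by
      rw [abs_le] at *; constructor <;> linarith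
    have A0 : ∀ x : ℝ, |x| ≤ L / 4 → |x| ≤ 3 * L / 8 := fun x a => by linarith
    apply comp0 (L / 4) (L / 4) (T / 2) t1
      (fun x y t => u (x + h) y t + u (x - h) y t - 2 * u x y t + M * h ^ 2)
      (fun x y t => pdx u (x + h) y t + pdx u (x - h) y t - 2 * pdx u x y t)
      (fun x y t => pdy u (x + h) y t + pdy u (x - h) y t - 2 * pdy u x y t)
      (fun x y t => pdt u (x + h) y t + pdt u (x - h) y t - 2 * pdt u x y t)
      (fun x y t => pdxx u (x + h) y t + pdxx u (x - h) y t - 2 * pdxx u x y t)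
      (fun x y t => pdyy u (x + h) y t + pdyy u (x - h) y t - 2 * pdyy u x y t)
    · intro x y t a b c
      have c1 := C21At.shift (u := u) (x := x) (y := y) (t := t) h 0 0 (by
        simpa using R (x + h) y t (A1 x a) b c)
      have c3 := C21At.shift (u := u) (x := x) (y := y) (t := t) (-h) 0 0 (by
        simpa [sub_eq_add_neg] using R (x - h) y t (A2 x a) b c)
      simp only [add_zero, ← sub_eq_add_neg] at c1 c3
      have c2 := (R x y t (A0 x a) b c).cont
      exact ((c1.add c3).sub (c2.const_mul 2)).add continuousAt_const
    · intro x y t a b c d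
      by_cases hy0 : y = 0
      · have ht : t ∈ Ioo 0 T := ⟨by linarith [c.1], by linarith [c.2, ht1.2]⟩
        rw [hy0, hsol.bc (x := x) (by linarith) ht, hsol.bc (x := x + h) (by linarith [A1 x a]) ht,
          hsol.bc (x := x - h) (by linarith [A2 x a]) ht]
        simp; positivity
      · have AA : ∀ s ∈ Icc (x - h) (x + h), |s| ≤ 3 * L / 8 := by
          intro s hs
          rw [abs_le] at *
          constructor <;> linarith [hs.1, hs.2]
        refine second_diff (fun s => u s y t) (fun s => pdx u s y t) (fun s => pdxx u s y t) x h M h0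
          (fun s hs => (R s y t (AA s hs) b c).dx) (fun s hs => (R s y t (AA s hs) b c).dxx) ?_
        intro s hs
        refine (abs_le.1 (hb s y t (by linarith [AA s hs]) ⟨b.1, by linarith [b.2]⟩
              ⟨by linarith [c.1, hs.1], by linarith [c.2, ht1.2]⟩ ?_).2.2.2.1).1
        have q1 := abs_nonneg s
        have q2 := b.1
        have q3 : t < T := by linarith [c.2, ht1.2]
        rcases d with d | d | d | d
        · have : |x| ≤ |s| + h := by
            have h1 := abs_sub_abs_le_abs_sub x s
            have h2 : |x - s| ≤ h := by rw [abs_le]; constructor <;> linarith [hs.1, hs.2]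
            linarith
          linarith
        · exact absurd d hy0
        · linarith
        · linarith
    · intro x y t a b c
      have b' := Ioo_subset_Icc_self b
      have c' := Ioc_subset_Icc_self c
      have e1 := (R _ y t (A1 x a.le) b' c').dx.comp_add_const x h
      have e2 := (R _ y t (A2 x a.le) b' c').dx.comp_sub_const x h
      have e3 := (R _ y t (A0 x a.le) b' c').dx
      exact ((e1.add e2).sub (e3.const_mul 2)).add_const _
    · intro x y t a b c
      have b' := Ioo_subset_Icc_self b
      have c' := Ioc_subset_Icc_self c
      have e1 := (R _ y t (A1 x a.le) b' c').dy
      have e2 := (R _ y t (A2 x a.le) b' c').dy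
      have e3 := (R _ y t (A0 x a.le) b' c').dy
      exact ((e1.add e2).sub (e3.const_mul 2)).add_const _
    · intro x y t a b c
      have b' := Ioo_subset_Icc_self b
      have c' := Ioc_subset_Icc_self c
      have e1 := (R _ y t (A1 x a.le) b' c').dt
      have e2 := (R _ y t (A2 x a.le) b' c').dt
      have e3 := (R _ y t (A0 x a.le) b' c').dt
      exact ((e1.add e2).sub (e3.const_mul 2)).add_const _
    · intro x y t a b c
      have b' := Ioo_subset_Icc_self b
      have c' := Ioc_subset_Icc_self c
      have e1 := (R _ y t (A1 x a.le) b' c').dxx.comp_add_const x h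
      have e2 := (R _ y t (A2 x a.le) b' c').dxx.comp_sub_const x h
      have e3 := (R _ y t (A0 x a.le) b' c').dxx
      exact (e1.add e2).sub (e3.const_mul 2)
    · intro x y t a b c
      have b' := Ioo_subset_Icc_self b
      have c' := Ioc_subset_Icc_self c
      have e1 := (R _ y t (A1 x a.le) b' c').dyy
      have e2 := (R _ y t (A2 x a.le) b' c').dyy
      have e3 := (R _ y t (A0 x a.le) b' c').dyy
      exact (e1.add e2).sub (e3.const_mul 2)
    · intro x y t a b c _ d1 d2
      have hb' : y ∈ Ioo 0 L := ⟨b.1, by linarith [b.2]⟩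
      have ht : t ∈ Ioo 0 T := ⟨by linarith [c.1], by linarith [c.2, ht1.2]⟩
      have p1 := hsol.pde (x := x) (by linarith) hb' ht
      have p2 := hsol.pde (x := x + h) (by linarith [A1 x a.le]) hb' ht
      have p3 := hsol.pde (x := x - h) (by linarith [A2 x a.le]) hb' ht
      have g1 := grad_ineq p (pdx u x y t) (pdy u x y t) (pdx u (x + h) y t - pdx u x y t)
        (pdy u (x + h) y t - pdy u x y t) hp
      have g2 := grad_ineq p (pdx u x y t) (pdy u x y t) (-(pdx u (x + h) y t - pdx u x y t))
        (-(pdy u (x + h) y t - pdy u x y t)) hp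
      have f1 : pdx u x y t + -(pdx u (x + h) y t - pdx u x y t) = pdx u (x - h) y t := by linarith
      have f2 : pdy u x y t + -(pdy u (x + h) y t - pdy u x y t) = pdy u (x - h) y t := by linarith
      rw [f1, f2] at g2
      rw [add_sub_cancel, add_sub_cancel] at g1
      unfold gradNorm at p1 p2 p3
      rw [← p1, ← p2] at g1
      rw [← p1, ← p3] at g2
      linarith
  intro x y t a b c
  -- extend from the interior in `x` is not needed: all points are regular
  have R : ∀ s, |s| < L → C21At u s y t := fun s hs => hsol.smooth hs.le ⟨b.1, by linarith [b.2]⟩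
    ⟨by linarith [c.1], c.2⟩
  have ev : ∀ᶠ h in nhds (0:ℝ), |h| < L / 8 :=
    (continuous_abs.tendsto' (0:ℝ) 0 abs_zero).eventually_lt_const (by positivity)
  have B1 : ∀ h : ℝ, |h| < L / 8 → |x + h| < L := fun h hh => by
    rw [abs_lt] at *; rw [abs_le] at a; constructor <;> linarith
  have B2 : ∀ h : ℝ, |h| < L / 8 → |x - h| < L := fun h hh => by
    rw [abs_lt] at *; rw [abs_le] at a; constructor <;> linarith
  have hsd := sd_test (fun h => u (x + h) y t + u (x - h) y t + M * h ^ 2)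
    (fun h => pdx u (x + h) y t + -pdx u (x - h) y t + M * (2 * h))
    (pdxx u x y t + pdxx u x y t + M * 2) 0
    (ev.mono fun s hs => by
      have a1 := (R (x + s) (B1 s hs)).dx.comp_const_add x s
      have a2 := (R (x - s) (B2 s hs)).dx.comp_const_sub x s
      have a3 : HasDerivAt (fun s : ℝ => M * s ^ 2) (M * (2 * s)) s := by
        simpa using (hasDerivAt_pow 2 s).const_mul M
      exact (a1.add a2).add a3)
    (by
      have hx : |x| < L := by linarith
      have a1 := HasDerivAt.comp_const_add (f := fun s => pdx u s y t) (f' := pdxx u x y t) x 0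
        (by simpa using (R x hx).dxx)
      have a2 := (HasDerivAt.comp_const_sub (f := fun s => pdx u s y t) (f' := pdxx u x y t) x 0
        (by simpa using (R x hx).dxx)).neg
      rw [neg_neg] at a2
      have a3 : HasDerivAt (fun s : ℝ => M * (2 * s)) (M * 2) 0 := by
        simpa using ((hasDerivAt_id (0:ℝ)).const_mul 2).const_mul M
      exact (a1.add a2).add a3)
    (ev.mono fun s hs => by
      have := key t c |s| (abs_nonneg s) hs x y t a b ⟨c.1, le_rfl⟩
      rw [sq_abs] at this
      simp only [add_zero, sub_zero]
      rcases abs_cases s with ⟨e, _⟩ | ⟨e, _⟩ <;> rw [e] at this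
      · linarith
      · rw [sub_neg_eq_add, ← sub_eq_add_neg] at this
        linarith)
  linarith [hsd.2]

/-! ### Consequences -/

theorem pack {p L T : ℝ} (hp : 2 < p) (hL : 0 < L) (hT : 0 < T) {u : ℝ → ℝ → ℝ → ℝ}
    (hsol : ClassicalSolution p L T u) (hext : ExtC21 L T u) :
    ∃ A > 0, ∀ x y t, |x| ≤ L / 4 → y ∈ Icc 0 (L / 4) → t ∈ Ico (T / 2) T →
      |pdt u x y t| ≤ A ∧ -A ≤ pdxx u x y t ∧ |pdx u x y t| ≤ A ∧ -A ≤ pdy u x y t ∧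
        (0 < y → pdyy u x y t ≤ A) := by
  obtain ⟨M1, hM1, h1⟩ := time_bound hL hT hsol hext
  obtain ⟨M2, hM2, h2⟩ := xx_bound hp hL hT hsol hext
  obtain ⟨M3, hM3, h3⟩ := bound_away hext (L / 4) (by positivity)
  have R : ∀ x y t, |x| ≤ L / 4 → y ∈ Icc 0 (L / 4) → t ∈ Ico (T / 2) T → C21At u x y t :=
    fun x y t a b c => hsol.smooth (by linarith) ⟨b.1, by linarith [b.2]⟩
        ⟨by linarith [c.1], by linarith [c.2]⟩
  have hyy : ∀ x y t, |x| ≤ L / 4 → y ∈ Icc 0 (L / 4) → t ∈ Ico (T / 2) T → 0 < y →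
      pdyy u x y t ≤ M1 + M2 := by
    intro x y t a b c hy
    have p1 := hsol.pde (x := x) (y := y) (t := t) (by linarith) ⟨hy, by linarith [b.2]⟩
        ⟨by linarith [c.1], c.2⟩
    have p2 : 0 ≤ gradNorm u x y t ^ p := Real.rpow_nonneg (Real.sqrt_nonneg _) _
    have := (abs_le.1 (h1 x y t a b c)).2
    have := h2 x y t a b c
    linarith
  refine ⟨M1 + M2 + M3 + M2 * L + (M1 + M2) * L, by positivity, ?_⟩
  intro x y t a b c
  have k1 : 0 ≤ M2 * L := by positivity
  have k2 : 0 ≤ (M1 + M2) * L := by positivity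
  have aa := abs_le.1 a
  refine ⟨by linarith [h1 x y t a b c], by linarith [h2 x y t a b c], ?_, ?_, ?_⟩
  · have b1 := (abs_le.1 (h3 (L / 4) y t (by rw [abs_of_pos] <;> linarith) ⟨b.1, by linarith [b.2]⟩
      ⟨c.1, c.2.le⟩ (by rw [abs_of_pos] <;> linarith [b.1, c.2])).1).2
    have b2 := (abs_le.1 (h3 (-(L / 4)) y t (by rw [abs_neg, abs_of_pos] <;> linarith)
      ⟨b.1, by linarith [b.2]⟩
      ⟨c.1, c.2.le⟩ (by rw [abs_neg, abs_of_pos] <;> linarith [b.1, c.2])).1).1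
    have c1 := mvt_lower (fun s => pdx u s y t) (fun s => pdxx u s y t) x (L / 4) (-M2) aa.2
      (fun s hs => (R s y t (abs_le.2 ⟨by linarith [hs.1], hs.2⟩) b c).dxx)
      (fun s hs => h2 s y t (abs_le.2 ⟨by linarith [hs.1], hs.2.le⟩) b c)
    have c2 := mvt_lower (fun s => pdx u s y t) (fun s => pdxx u s y t) (-(L / 4)) x (-M2) aa.1
      (fun s hs => (R s y t (abs_le.2 ⟨by linarith [hs.1], by linarith [hs.2]⟩) b c).dxx)
      (fun s hs => h2 s y t (abs_le.2 ⟨by linarith [hs.1], by linarith [hs.2]⟩) b c)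
    rw [abs_le]
    constructor <;> nlinarith
  · have b1 := (abs_le.1 (h3 x (L / 4) t (by linarith) ⟨by linarith, by linarith⟩
      ⟨c.1, c.2.le⟩ (by linarith [abs_nonneg x, c.2])).2.1).1
    have c1 := mvt_upper (fun s => pdy u x s t) (fun s => pdyy u x s t) y (L / 4) (M1 + M2) b.2
      (fun s hs => (R x s t a ⟨by linarith [hs.1, b.1], hs.2⟩ c).dyy)
      (fun s hs => hyy x s t a ⟨by linarith [hs.1, b.1], hs.2.le⟩ c (by linarith [hs.1, b.1]))
    nlinarith [b.1]
  · intro hy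
    linarith [hyy x y t a b c hy]

theorem le_center {p L T : ℝ} {u : ℝ → ℝ → ℝ → ℝ}
    (hsol : ClassicalSolution p L T u) (hmon : MonCond L T u) (x y t : ℝ) (hx : |x| < L)
    (hy : y ∈ Ioo 0 L) (ht : t ∈ Ioo 0 T) : u x y t ≤ u 0 y t := by
  have R : ∀ s, |s| < L → C21At u s y t := fun s hs => hsol.smooth hs.le ⟨hy.1.le, hy.2.le⟩ ht
  have hx' := abs_lt.1 hx
  rcases le_total 0 x with h | h
  · have := mvt_upper (fun s => u s y t) (fun s => pdx u s y t) 0 x 0 h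
      (fun s hs => (R s (abs_lt.2 ⟨by linarith [hs.1], by linarith [hs.2]⟩)).dx)
      (fun s hs => by
        have := hmon (x := s) (abs_lt.2 ⟨by linarith [hs.1], by linarith [hs.2]⟩) hy ht
        by_contra hc
        push Not at hc
        have := mul_pos hs.1 hc
        linarith)
    linarith
  · have := mvt_lower (fun s => u s y t) (fun s => pdx u s y t) x 0 0 h
      (fun s hs => (R s (abs_lt.2 ⟨by linarith [hs.1], by linarith [hs.2]⟩)).dx)
      (fun s hs => by
        have := hmon (x := s) (abs_lt.2 ⟨by linarith [hs.1], by linarith [hs.2]⟩) hy ht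
        by_contra hc
        push Not at hc
        have := mul_pos_of_neg_of_neg hs.2 hc
        linarith)
    linarith

theorem center {p L T : ℝ} (hL : 0 < L) {u : ℝ → ℝ → ℝ → ℝ}
    (hsol : ClassicalSolution p L T u) (hmon : MonCond L T u) (y t : ℝ)
    (hy : y ∈ Ioo 0 L) (ht : t ∈ Ioo 0 T) : pdx u 0 y t = 0 ∧ pdxx u 0 y t ≤ 0 := by
  have R : ∀ s, |s| < L → C21At u s y t := fun s hs => hsol.smooth hs.le ⟨hy.1.le, hy.2.le⟩ ht
  have ev : ∀ᶠ h in nhds (0:ℝ), |h| < L :=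
    (continuous_abs.tendsto' (0:ℝ) 0 abs_zero).eventually_lt_const hL
  have := sd_test (fun s => -u s y t) (fun s => -pdx u s y t) (-pdxx u 0 y t) 0
    (ev.mono fun s hs => (R s hs).dx.neg) ((R 0 (by simpa using hL)).dxx.neg)
    (ev.mono fun s hs => neg_le_neg (le_center hsol hmon s y t hs hy ht))
  exact ⟨by linarith [this.1], by linarith [this.2]⟩

theorem blow_center {p L T : ℝ} (hp : 2 < p) (hL : 0 < L) (hT : 0 < T) {u : ℝ → ℝ → ℝ → ℝ}
    (hsol : ClassicalSolution p L T u) (hgbu : IsolatedGBU L T u)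
    (hext : ExtC21 L T u) (hmon : MonCond L T u) (N t0 : ℝ) (ht0 : t0 < T) :
    ∃ t ∈ Ico (T / 2) T, t0 < t ∧ N < pdy u 0 0 t := by
  obtain ⟨A, hA, h⟩ := pack hp hL hT hsol hext
  obtain ⟨x, y, t, a1, a2, a3, a4, a5, a6, a7⟩ := hgbu.blowup (|N| + 2 * A + A * L)
    (min (L / 4) (min (T / 2) (T - t0)))
    (by have : 0 < T - t0 := by linarith
        positivity)
  have m1 := min_le_left (L / 4) (min (T / 2) (T - t0))
  have m2 := (min_le_right (L / 4) (min (T / 2) (T - t0))).trans (min_le_left _ _)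
  have m3 := (min_le_right (L / 4) (min (T / 2) (T - t0))).trans (min_le_right _ _)
  have c : t ∈ Ico (T / 2) T := ⟨by linarith, a3.2⟩
  have hy4 : y ≤ L / 4 := by linarith [le_abs_self y]
  refine ⟨t, c, by linarith, ?_⟩
  have b : y ∈ Icc 0 (L / 4) := ⟨a2.1, hy4⟩
  have a : |x| ≤ L / 4 := by linarith
  obtain ⟨-, -, q1, q2, -⟩ := h x y t a b c
  have hg : gradNorm u x y t ≤ |pdx u x y t| + |pdy u x y t| := by
    unfold gradNorm
    apply Real.sqrt_le_iff.2
    refine ⟨by positivity, ?_⟩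
    nlinarith [sq_abs (pdx u x y t), sq_abs (pdy u x y t),
      mul_nonneg (abs_nonneg (pdx u x y t)) (abs_nonneg (pdy u x y t))]
  have hAL : 0 ≤ A * L := by positivity
  have hpy : |N| + A * L < pdy u x y t := by
    rcases abs_cases (pdy u x y t) with ⟨e, _⟩ | ⟨e, _⟩
    · linarith
    · linarith [abs_nonneg N]
  have R : ∀ x y, |x| ≤ L / 4 → y ∈ Icc 0 (L / 4) → C21At u x y t :=
    fun x y a b => hsol.smooth (by linarith) ⟨b.1, by linarith [b.2]⟩ a3
  have c1 := mvt_upper (fun s => pdy u x s t) (fun s => pdyy u x s t) 0 y A b.1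
      (fun s hs => (R x s a ⟨hs.1, by linarith [hs.2]⟩).dyy)
      (fun s hs => (h x s t a ⟨hs.1.le, by linarith [hs.2]⟩ c).2.2.2.2 hs.1)
  have z0 : |(0:ℝ)| ≤ L / 4 := by simp; positivity
  have zz : (0:ℝ) ∈ Icc 0 (L / 4) := ⟨le_rfl, by positivity⟩
  have c2 := right_test (fun s => u 0 s t - u x s t) (pdy u 0 0 t - pdy u x 0 t) 0 (L / 4)
    ((R 0 0 z0 zz).dy.sub (R x 0 a zz).dy) (by positivity)
    (fun s hs => by
      have := le_center hsol hmon x s t (by linarith) ⟨hs.1, by linarith [hs.2]⟩ a3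
      rw [hsol.bc (x := 0) (by simpa using hL) a3, hsol.bc (x := x) (by linarith) a3]
      linarith)
  have : N ≤ |N| := le_abs_self N
  nlinarith [b.1]

/-! ### The one-dimensional profile -/

/-- The one-dimensional profile. -/
def prof (p η : ℝ) : ℝ := ((1/(p-1) : ℝ) ^ (1/(p-1))) * η ^ (-(1/(p-1)))

theorem prof_pos {p η : ℝ} (hp : 2 < p) (h : 0 < η) : 0 < prof p η := by
  have : 0 < 1 / (p - 1) := by apply div_pos <;> linarith
  unfold prof; positivity

theorem prof_anti {p η η' : ℝ} (hp : 2 < p) (h : 0 < η) (h' : η ≤ η') : prof p η' ≤ prof p η := by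
  have : 0 < 1 / (p - 1) := by apply div_pos <;> linarith
  unfold prof
  exact mul_le_mul_of_nonneg_left (Real.rpow_le_rpow_of_nonpos h h' (by linarith)) (by positivity)

theorem prof_scale {p η l : ℝ} (hη : 0 < η) (hl : 0 < l) :
    prof p (l * η) = l ^ (-(1/(p-1))) * prof p η := by
  unfold prof
  rw [Real.mul_rpow hl.le hη.le]; ring

theorem prof_deriv {p η : ℝ} (hp : 2 < p) (h : 0 < η) :
    HasDerivAt (prof p) (-(prof p η) ^ p) η := by
  have hb : 0 < 1 / (p - 1) := by apply div_pos <;> linarith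
  have h1 := (Real.hasDerivAt_rpow_const (x := η) (p := -(1/(p-1))) (Or.inl h.ne')).const_mul
    ((1/(p-1) : ℝ) ^ (1/(p-1)))
  have e : ((1/(p-1) : ℝ) ^ (1/(p-1))) * (-(1/(p-1)) * η ^ (-(1/(p-1)) - 1)) = -(prof p η) ^ p := by
    unfold prof
    rw [Real.mul_rpow (by positivity) (by positivity), ← Real.rpow_mul hb.le, ← Real.rpow_mul h.le]
    have hp1 : p - 1 ≠ 0 := by linarith
    have e1 : 1 / (p - 1) * p = 1 / (p - 1) + 1 := by field_simp; ring
    have e2 : -(1 / (p - 1)) * p = -(1 / (p - 1)) - 1 := by field_simp; ring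
    rw [e1, e2, Real.rpow_add hb, Real.rpow_one]; ring
  rw [← e]; exact h1

theorem prof_deriv2 {p η : ℝ} (hp : 2 < p) (h : 0 < η) :
    HasDerivAt (fun s => -(prof p s) ^ p) (p * (prof p η) ^ (p - 1) * (prof p η) ^ p) η := by
  have h1 := ((prof_deriv hp h).rpow_const (p := p) (Or.inl (prof_pos hp h).ne')).neg
  have e : p * (prof p η) ^ (p - 1) * (prof p η) ^ p =
    -(-(prof p η) ^ p * p * (prof p η) ^ (p - 1)) := by ring
  rw [e]; exact h1

/-- ODE comparison -/
theorem ode_lower {p A r ε : ℝ} (hp : 2 < p) (hA : 0 < A) (hε : 0 < ε) (v v' : ℝ → ℝ)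
    (hv : ∀ y ∈ Icc 0 r, HasDerivAt v (v' y) y)
    (hv' : ∀ y ∈ Ioo 0 r, -A - |v y| ^ p ≤ v' y) (hvA : ∀ y ∈ Icc 0 r, -A ≤ v y)
    (h0 : prof p ε ≤ v 0) : ∀ y ∈ Icc 0 r, prof p (y + ε) - (3 * A + 1) ≤ v y := by
  have hd : ∀ y ∈ Icc 0 r, HasDerivAt (fun y => prof p (y + ε) - (3 * A + 1))
      (-(prof p (y + ε)) ^ p) y := fun y hy =>
    ((prof_deriv hp (by linarith [hy.1])).comp_add_const y ε).sub_const _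
  refine image_le_of_deriv_right_lt_deriv_boundary' (f' := fun y => -(prof p (y + ε)) ^ p)
    (B' := v') (fun y hy => (hd y hy).continuousAt.continuousWithinAt)
    (fun y hy => (hd y ⟨hy.1, hy.2.le⟩).hasDerivWithinAt) ?_
    (fun y hy => (hv y hy).continuousAt.continuousWithinAt)
    (fun y hy => (hv y ⟨hy.1, hy.2.le⟩).hasDerivWithinAt) ?_
  · simp only [zero_add]; linarith
  · intro y hy he
    rcases hy.1.eq_or_lt with h | h
    · subst h
      simp only [zero_add] at he
      linarith
    · have hb := hv' y ⟨h, hy.2⟩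
      have hA' := hvA y ⟨hy.1, hy.2.le⟩
      have e : prof p (y + ε) = (v y + 2 * A) + (A + 1) := by linarith
      have s := Real.add_rpow_le_rpow_add (p := p) (a := v y + 2 * A) (b := A + 1) (by linarith)
        (by linarith) (by linarith)
      have s1 : |v y| ^ p ≤ (v y + 2 * A) ^ p :=
        Real.rpow_le_rpow (abs_nonneg _) (abs_le.2 ⟨by linarith, by linarith⟩) (by linarith)
      have s2 : A + 1 ≤ (A + 1) ^ p := Real.self_le_rpow_of_one_le (by linarith) (by linarith)
      rw [e]
      linarith

/-! ### Lower bound on the boundary -/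

theorem center_lower {p L T : ℝ} (hp : 2 < p) (hL : 0 < L) (hT : 0 < T) {u : ℝ → ℝ → ℝ → ℝ}
    (hsol : ClassicalSolution p L T u) (hgbu : IsolatedGBU L T u)
    (hext : ExtC21 L T u) (hmon : MonCond L T u) :
    ∃ C > 0, ∀ y ∈ Ioc 0 (L / 4), ∀ t ∈ Ico (T / 2) T,
      y * prof p (2 * y) - C * y - C * (T - t) ≤ u 0 y t := by
  obtain ⟨A, hA, h⟩ := pack hp hL hT hsol hext
  refine ⟨3 * A + 1, by positivity, ?_⟩
  intro y hy t ht
  obtain ⟨t', c, htt, hN⟩ := blow_center hp hL hT hsol hgbu hext hmon (prof p y) t ht.2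
  have z0 : |(0:ℝ)| ≤ L / 4 := by simp; positivity
  have tt : t' ∈ Ioo 0 T := ⟨by linarith [c.1], c.2⟩
  have R : ∀ y ∈ Icc 0 (L / 4), C21At u 0 y t' :=
    fun y b => hsol.smooth (by simpa using hL.le) ⟨b.1, by linarith [b.2]⟩ tt
  have ode := ode_lower (p := p) (A := A) (r := L / 4) (ε := y) hp hA hy.1
    (fun s => pdy u 0 s t') (fun s => pdyy u 0 s t')
    (fun s hs => (R s hs).dyy)
    (fun s hs => by
      have hs' : s ∈ Ioo 0 L := ⟨hs.1, by linarith [hs.2]⟩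
      have p1 := hsol.pde (x := 0) (y := s) (t := t') (by simpa using hL) hs' tt
      obtain ⟨c1, c2⟩ := center hL hsol hmon s t' hs' tt
      have e : gradNorm u 0 s t' = |pdy u 0 s t'| := by
        unfold gradNorm; rw [c1]; simp [Real.sqrt_sq_eq_abs]
      rw [e] at p1
      have := (abs_le.1 (h 0 s t' z0 ⟨hs.1.le, hs.2.le⟩ c).1).1
      linarith)
    (fun s hs => (h 0 s t' z0 hs c).2.2.2.1)
    hN.le
  have m1 := mvt_lower (fun s => u 0 s t') (fun s => pdy u 0 s t') 0 y
    (prof p (2 * y) - (3 * A + 1)) hy.1.le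
    (fun s hs => (R s ⟨hs.1, hs.2.trans hy.2⟩).dy)
    (fun s hs => by
      have o := ode s ⟨hs.1.le, hs.2.le.trans hy.2⟩
      have a := prof_anti hp (η := s + y) (η' := 2 * y) (by linarith [hs.1, hy.1]) (by linarith [hs.2])
      linarith)
  have m2 := mvt_upper (fun s => u 0 y s) (fun s => pdt u 0 y s) t t' A htt.le
    (fun s hs => (hsol.smooth (by simpa using hL.le) ⟨hy.1.le, by linarith [hy.2]⟩
      ⟨by linarith [hs.1, ht.1], by linarith [hs.2, c.2]⟩ : C21At u 0 y s).dt)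
    (fun s hs => (abs_le.1 (h 0 y s z0 ⟨hy.1.le, hy.2⟩
      ⟨by linarith [hs.1, ht.1], by linarith [hs.2, c.2]⟩).1).2)
  rw [hsol.bc (x := 0) (by simpa using hL) tt] at m1
  nlinarith [c.2]

theorem side_lower {p L T : ℝ} (hp : 2 < p) (hL : 0 < L) (hT : 0 < T) {u : ℝ → ℝ → ℝ → ℝ}
    (hsol : ClassicalSolution p L T u) (hgbu : IsolatedGBU L T u)
    (hext : ExtC21 L T u) (hmon : MonCond L T u) :
    ∃ C > 0, ∀ x y t, |x| ≤ L / 4 → y ∈ Ioc 0 (L / 4) → t ∈ Ico (T / 2) T →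
      prof p (2 * y) - C - C * (x ^ 2 + (T - t)) / y ≤ pdy u x 0 t := by
  obtain ⟨A, hA, h⟩ := pack hp hL hT hsol hext
  obtain ⟨C, hC, hc⟩ := center_lower hp hL hT hsol hgbu hext hmon
  refine ⟨C + A + A * L, by positivity, ?_⟩
  intro x y t a b c
  have tt : t ∈ Ioo 0 T := ⟨by linarith [c.1], c.2⟩
  have b' : y ∈ Icc 0 (L / 4) := ⟨b.1.le, b.2⟩
  have R : ∀ x y, |x| ≤ L / 4 → y ∈ Icc 0 (L / 4) → C21At u x y t :=
    fun x y a b => hsol.smooth (by linarith) ⟨b.1, by linarith [b.2]⟩ tt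
  have h0 := (center hL hsol hmon y t ⟨b.1, by linarith [b.2]⟩ tt).1
  have aa := abs_le.1 a
  have k1 : u 0 y t - A * x ^ 2 ≤ u x y t := by
    rcases le_total 0 x with hx | hx
    · have m := mvt_lower (fun s => u s y t) (fun s => pdx u s y t) 0 x (-A * x) hx
        (fun s hs => (R s y (abs_le.2 ⟨by linarith [hs.1], by linarith [hs.2]⟩) b').dx)
        (fun s hs => by
          have m' := mvt_lower (fun s => pdx u s y t) (fun s => pdxx u s y t) 0 s (-A) hs.1.le
            (fun z hz => (R z y (abs_le.2 ⟨by linarith [hz.1], by linarith [hz.2, hs.2]⟩) b').dxx)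
            (fun z hz => (h z y t (abs_le.2 ⟨by linarith [hz.1], by linarith [hz.2, hs.2]⟩) b' c).2.1)
          rw [h0] at m'
          nlinarith [hs.2])
      nlinarith
    · have m := mvt_upper (fun s => u s y t) (fun s => pdx u s y t) x 0 (-A * x) hx
        (fun s hs => (R s y (abs_le.2 ⟨by linarith [hs.1], by linarith [hs.2]⟩) b').dx)
        (fun s hs => by
          have m' := mvt_lower (fun s => pdx u s y t) (fun s => pdxx u s y t) s 0 (-A) hs.2.le
            (fun z hz => (R z y (abs_le.2 ⟨by linarith [hz.1, hs.1], by linarith [hz.2]⟩) b').dxx)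
            (fun z hz => (h z y t (abs_le.2 ⟨by linarith [hz.1, hs.1], by linarith [hz.2]⟩) b' c).2.1)
          rw [h0] at m'
          nlinarith [hs.1])
      nlinarith
  have k2 := mvt_upper (fun s => u x s t) (fun s => pdy u x s t) 0 y (pdy u x 0 t + A * y) b.1.le
    (fun s hs => (R x s a ⟨hs.1, hs.2.trans b.2⟩).dy)
    (fun s hs => by
      have m' := mvt_upper (fun s => pdy u x s t) (fun s => pdyy u x s t) 0 s A hs.1.le
        (fun z hz => (R x z a ⟨hz.1, by linarith [hz.2, hs.2, b.2]⟩).dyy)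
        (fun z hz => (h x z t a ⟨hz.1.le, by linarith [hz.2, hs.2, b.2]⟩ c).2.2.2.2 hz.1)
      nlinarith [hs.2])
  rw [hsol.bc (x := x) (by linarith) tt] at k2
  have k3 := hc y b t c
  have hy := b.1
  have e : (C + A + A * L) * (x ^ 2 + (T - t)) / y * y = (C + A + A * L) * (x ^ 2 + (T - t)) := by
    field_simp
  have s0 : 0 ≤ T - t := by linarith [c.2]
  have k4 : C * (T - t) + A * x ^ 2 ≤ (C + A + A * L) * (x ^ 2 + (T - t)) := by
    have : 0 ≤ A * L := by positivity
    nlinarith [mul_nonneg hA.le s0, mul_nonneg hC.le (sq_nonneg x), mul_nonneg this s0,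
      mul_nonneg this (sq_nonneg x)]
  have k5 : A * y * y ≤ A * L * y := by
    apply mul_le_mul_of_nonneg_right _ hy.le
    apply mul_le_mul_of_nonneg_left _ hA.le
    linarith [b.2]
  have k6 : 0 ≤ A * y := by positivity
  refine le_of_mul_le_mul_right ?_ hy
  rw [sub_mul, e]
  nlinarith

theorem bdry_lower {p L T : ℝ} (hp : 2 < p) (hL : 0 < L) (hT : 0 < T) {u : ℝ → ℝ → ℝ → ℝ}
    (hsol : ClassicalSolution p L T u) (hgbu : IsolatedGBU L T u)
    (hext : ExtC21 L T u) (hmon : MonCond L T u) :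
    ∃ C₁ > 0, ∃ C > 0, ∀ x t, |x| ≤ L / 4 → t ∈ Ico (T / 2) T →
      prof p (C₁ * (x ^ 2 + (T - t)) ^ ((p - 1) / (p - 2))) - C ≤ pdy u x 0 t := by
  obtain ⟨A, hA, h⟩ := pack hp hL hT hsol hext
  obtain ⟨B, hB, hb⟩ := side_lower hp hL hT hsol hgbu hext hmon
  have hp1 : 0 < p - 1 := by linarith
  have hp2 : 0 < p - 2 := by linarith
  have hβ : 0 < 1 / (p - 1) := by positivity
  set d : ℝ := (1 / (p - 1)) ^ (1 / (p - 1)) with hd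
  have hd0 : 0 < d := by positivity
  set K0 : ℝ := 2 * B * (2:ℝ) ^ (1 / (p - 1)) / d with hK0
  have hK : 0 < K0 := by positivity
  set κ : ℝ := K0 ^ ((p - 1) / (p - 2)) with hκ
  have hκ0 : 0 < κ := by positivity
  have hκ1 : κ ^ ((p - 2) / (p - 1)) = K0 := by
    rw [hκ, ← Real.rpow_mul hK.le]
    have : (p - 1) / (p - 2) * ((p - 2) / (p - 1)) = 1 := by field_simp
    rw [this, Real.rpow_one]
  set l : ℝ := (2:ℝ) ^ (p - 1) with hl
  have hl0 : 0 < l := by positivity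
  have hl1 : l ^ (-(1 / (p - 1))) = 1 / 2 := by
    rw [hl, ← Real.rpow_mul (by norm_num)]
    have : (p - 1) * -(1 / (p - 1)) = -1 := by field_simp
    rw [this, Real.rpow_neg_one]; norm_num
  refine ⟨l * (2 * κ), by positivity, A + B + prof p (l * (2 * (L / 4))), ?_, ?_⟩
  · have := prof_pos hp (η := l * (2 * (L / 4))) (by positivity)
    positivity
  intro x t a c
  have hX : 0 < x ^ 2 + (T - t) := by
    have : 0 < T - t := by linarith [c.2]
    positivity
  set X := x ^ 2 + (T - t) with hXd
  set y := κ * X ^ ((p - 1) / (p - 2)) with hy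
  have hy0 : 0 < y := by positivity
  have e1 : l * (2 * κ) * X ^ ((p - 1) / (p - 2)) = l * (2 * y) := by rw [hy]; ring
  rw [e1]
  have hpos := prof_pos hp (η := l * (2 * (L / 4))) (by positivity)
  rcases le_or_gt y (L / 4) with hyL | hyL
  · have k := hb x y t a ⟨hy0, hyL⟩ c
    have e2 : prof p (l * (2 * y)) = 1 / 2 * prof p (2 * y) := by
      rw [prof_scale (by positivity) hl0, hl1]
    have e3 : B * X / y = 1 / 2 * prof p (2 * y) := by
      -- both sides are explicit powers
      have q1 : prof p (2 * y) = d * ((2:ℝ) ^ (1 / (p - 1)))⁻¹ * y ^ (-(1 / (p - 1))) := by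
        unfold prof
        rw [Real.mul_rpow (by norm_num) hy0.le, Real.rpow_neg (by norm_num : (0:ℝ) ≤ 2)]; ring
      have q2 : y ^ (-(1 / (p - 1))) = y ^ ((p - 2) / (p - 1)) / y := by
        rw [← Real.rpow_sub_one hy0.ne']
        congr 1; field_simp; ring
      have q3 : y ^ ((p - 2) / (p - 1)) = K0 * X := by
        rw [hy, Real.mul_rpow hκ0.le (by positivity), hκ1, ← Real.rpow_mul hX.le]
        have : (p - 1) / (p - 2) * ((p - 2) / (p - 1)) = 1 := by field_simp
        rw [this, Real.rpow_one]
      rw [q1, q2, q3, hK0]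
      have : (2:ℝ) ^ (1 / (p - 1)) ≠ 0 := by positivity
      field_simp
    rw [e2]
    rw [e3] at k
    linarith
  · have k := (h x 0 t a ⟨le_rfl, by positivity⟩ c).2.2.2.1
    have := prof_anti hp (η := l * (2 * (L / 4))) (η' := l * (2 * y)) (by positivity)
      (by apply mul_le_mul_of_nonneg_left _ hl0.le; linarith)
    linarith

/-! ### Interior lower bound -/

theorem alg_key {p F A c K w v : ℝ} (hp : 2 < p) (hF : c ≤ F) (hc : 1 ≤ c) (hK : K ≤ c)
    (hw : |w| ≤ A) (hv : v ≤ F - (A + c)) :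
    p * (w ^ 2 + v ^ 2) ^ (p / 2 - 1) * v + K ≤ p * F ^ (p - 1) := by
  have hA : 0 ≤ A := (abs_nonneg w).trans hw
  have hG : 0 ≤ (w ^ 2 + v ^ 2) ^ (p / 2 - 1) := Real.rpow_nonneg (by positivity) _
  have hcc : c ≤ c ^ (p - 1) := Real.self_le_rpow_of_one_le hc (by linarith)
  have hcp : c ^ (p - 1) ≤ p * c ^ (p - 1) := by
    have : 0 ≤ c ^ (p - 1) := by linarith
    nlinarith
  rcases le_or_gt v 0 with h | h
  · have h1 : p * (w ^ 2 + v ^ 2) ^ (p / 2 - 1) * v ≤ 0 :=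
      mul_nonpos_of_nonneg_of_nonpos (by positivity) h
    have h2 : c ^ (p - 1) ≤ F ^ (p - 1) := Real.rpow_le_rpow (by linarith) hF (by linarith)
    have h3 : p * c ^ (p - 1) ≤ p * F ^ (p - 1) := mul_le_mul_of_nonneg_left h2 (by linarith)
    linarith
  · have e1 : (w ^ 2 + v ^ 2) ^ (p / 2 - 1) ≤ (A + v) ^ (p - 2) := by
      have : (A + v) ^ (p - 2) = ((A + v) ^ 2) ^ (p / 2 - 1) := by
        rw [← Real.rpow_natCast, ← Real.rpow_mul (by linarith)]
        congr 1; push_cast; ring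
      rw [this]
      apply Real.rpow_le_rpow (by positivity) _ (by linarith)
      have := sq_le_sq' (by linarith [abs_nonneg w]) hw
      rw [sq_abs] at this
      nlinarith
    have e2 : (w ^ 2 + v ^ 2) ^ (p / 2 - 1) * v ≤ (A + v) ^ (p - 1) := by
      have : (A + v) ^ (p - 1) = (A + v) ^ (p - 2) * (A + v) := by
        rw [← Real.rpow_add_one (by linarith)]; congr 1; ring
      rw [this]
      exact mul_le_mul e1 (by linarith) h.le (Real.rpow_nonneg (by linarith) _)
    have e3 : (A + v) ^ (p - 1) ≤ (F - c) ^ (p - 1) :=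
      Real.rpow_le_rpow (by linarith) (by linarith) (by linarith)
    have e4 := Real.add_rpow_le_rpow_add (p := p - 1) (a := F - c) (b := c) (by linarith)
      (by linarith) (by linarith)
    rw [sub_add_cancel] at e4
    have e5 : p * ((w ^ 2 + v ^ 2) ^ (p / 2 - 1) * v) ≤ p * (F ^ (p - 1) - c ^ (p - 1)) :=
      mul_le_mul_of_nonneg_left (by linarith) (by linarith)
    rw [mul_assoc]
    linarith

theorem eta_dx (γ s x : ℝ) (hs : 0 < s) :
    HasDerivAt (fun x : ℝ => (x ^ 2 + s) ^ γ) (2 * x * γ * (x ^ 2 + s) ^ (γ - 1)) x := by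
  have h1 : HasDerivAt (fun x : ℝ => x ^ 2 + s) (2 * x) x := by
    simpa using (hasDerivAt_pow 2 x).add_const s
  exact h1.rpow_const (Or.inl (by positivity))

theorem eta_dxx (γ s x : ℝ) (hs : 0 < s) :
    HasDerivAt (fun x : ℝ => 2 * x * γ * (x ^ 2 + s) ^ (γ - 1))
      (2 * γ * (x ^ 2 + s) ^ (γ - 1) +
        2 * x * γ * (2 * x * (γ - 1) * (x ^ 2 + s) ^ (γ - 1 - 1))) x := by
  have h1 : HasDerivAt (fun x : ℝ => 2 * x * γ) (2 * γ) x := by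
    simpa using ((hasDerivAt_id x).const_mul 2).mul_const γ
  exact h1.mul (eta_dx (γ - 1) s x hs)

theorem eta_dt (γ T x t : ℝ) (hs : t < T) :
    HasDerivAt (fun t : ℝ => (x ^ 2 + (T - t)) ^ γ) (-1 * γ * (x ^ 2 + (T - t)) ^ (γ - 1)) t := by
  have h1 : HasDerivAt (fun t : ℝ => x ^ 2 + (T - t)) (-1) t := by
    simpa using ((hasDerivAt_id t).const_sub T).const_add (x ^ 2)
  have : 0 < T - t := by linarith
  exact h1.rpow_const (Or.inl (by positivity))

theorem eta_bound (γ s x Y : ℝ) (hγ : 1 < γ) (hs : 0 < s) (hY : x ^ 2 + s ≤ Y) :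
    γ * (x ^ 2 + s) ^ (γ - 1) + (2 * γ * (x ^ 2 + s) ^ (γ - 1) +
        2 * x * γ * (2 * x * (γ - 1) * (x ^ 2 + s) ^ (γ - 1 - 1))) ≤
      (3 * γ + 4 * γ * (γ - 1)) * Y ^ (γ - 1) := by
  have hX : 0 < x ^ 2 + s := by positivity
  have e : (x ^ 2 + s) ^ (γ - 1 - 1) * (x ^ 2 + s) = (x ^ 2 + s) ^ (γ - 1) := by
    rw [Real.rpow_sub_one hX.ne']; field_simp
  have h1 : (x ^ 2 + s) ^ (γ - 1 - 1) * x ^ 2 ≤ (x ^ 2 + s) ^ (γ - 1) := by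
    rw [← e]
    exact mul_le_mul_of_nonneg_left (by linarith) (Real.rpow_nonneg hX.le _)
  have h2 : (x ^ 2 + s) ^ (γ - 1) ≤ Y ^ (γ - 1) := Real.rpow_le_rpow hX.le hY (by linarith)
  have h3 : 0 ≤ 4 * γ * (γ - 1) := mul_nonneg (by linarith) (by linarith)
  calc _ = 3 * γ * (x ^ 2 + s) ^ (γ - 1) +
        4 * γ * (γ - 1) * ((x ^ 2 + s) ^ (γ - 1 - 1) * x ^ 2) := by ring
    _ ≤ 3 * γ * Y ^ (γ - 1) + 4 * γ * (γ - 1) * Y ^ (γ - 1) :=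
      add_le_add (mul_le_mul_of_nonneg_left h2 (by linarith))
        (mul_le_mul_of_nonneg_left (h1.trans h2) h3)
    _ = _ := by ring

set_option maxHeartbeats 4000000 in
theorem interior_lower {p L T : ℝ} (hp : 2 < p) (hL : 0 < L) (hT : 0 < T) {u : ℝ → ℝ → ℝ → ℝ}
    (hsol : ClassicalSolution p L T u) (hgbu : IsolatedGBU L T u)
    (hext : ExtC21 L T u) (hmon : MonCond L T u) :
    ∃ C₁ > 0, ∃ C₂ > 0, ∀ x y t, |x| ≤ L / 4 → y ∈ Icc 0 (L / 8) → t ∈ Ico (T / 2) T →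
      prof p (y + C₁ * (x ^ 2 + (T - t)) ^ ((p - 1) / (p - 2))) - C₂ ≤ pdy u x y t := by
  obtain ⟨A, hA, hpk⟩ := pack hp hL hT hsol hext
  obtain ⟨C₁, hC₁, C, hC, hbl⟩ := bdry_lower hp hL hT hsol hgbu hext hmon
  have hp1 : 0 < p - 1 := by linarith
  have hp2 : 0 < p - 2 := by linarith
  have hγ : 1 < (p - 1) / (p - 2) := by rw [lt_div_iff₀ hp2]; linarith
  set γ := (p - 1) / (p - 2) with hγd
  set K : ℝ := C₁ * ((3 * γ + 4 * γ * (γ - 1)) * (L ^ 2 + T) ^ (γ - 1)) with hK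
  have hK0 : 0 ≤ K := by
    have : 0 ≤ 4 * γ * (γ - 1) := mul_nonneg (by linarith) (by linarith)
    have : 0 ≤ 3 * γ + 4 * γ * (γ - 1) := by linarith
    positivity
  have P1 := prof_pos hp (η := L / 8) (by positivity)
  have P2 := prof_pos hp (η := C₁ * (T / 2) ^ γ) (by positivity)
  have P3 := prof_pos hp (η := C₁ * ((L / 4) ^ 2) ^ γ) (by positivity)
  set C₂ : ℝ := 2 * A + 2 + (K + 1) + C + prof p (L / 8) + prof p (C₁ * (T / 2) ^ γ) +
    prof p (C₁ * ((L / 4) ^ 2) ^ γ) with hC₂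
  refine ⟨C₁, hC₁, C₂, by positivity, ?_⟩
  intro x y τ ax ay aτ
  obtain ⟨M, hM, hMb⟩ := bound_away hext (T - τ) (by linarith [aτ.2])
  have Rg : ∀ x y t, |x| ≤ L / 4 → y ∈ Icc 0 (L / 4) → t ∈ Icc (T / 2) τ → C21At u x y t :=
    fun x y t a b c => hsol.smooth (by linarith) ⟨b.1, by linarith [b.2]⟩
        ⟨by linarith [c.1], by linarith [c.2, aτ.2]⟩
  -- the increments of `u` in `y`
  have inc : ∀ h, 0 < h → h < L / 8 → ∀ x y t, |x| ≤ L / 4 → y ∈ Icc 0 (L / 8) →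
      t ∈ Icc (T / 2) τ → (pdy u x y t - M * h) * h ≤ u x (y + h) t - u x y t := by
    intro h h0 h1 x y t a b c
    have m := mvt_lower (fun s => u x s t) (fun s => pdy u x s t) y (y + h)
      (pdy u x y t - M * h) (by linarith)
      (fun s hs => (Rg x s t a ⟨by linarith [hs.1, b.1], by linarith [hs.2, b.2]⟩ c).dy)
      (fun s hs => by
        have m' := mvt_lower (fun s => pdy u x s t) (fun s => pdyy u x s t) y s (-M) hs.1.le
          (fun z hz => (Rg x z t a ⟨by linarith [hz.1, b.1], by linarith [hs.2, hz.2, b.2]⟩ c).dyy)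
          (fun z hz => (abs_le.1 (hMb x z t (by linarith)
            ⟨by linarith [hz.1, b.1], by linarith [hs.2, hz.2, b.2]⟩
            ⟨c.1, by linarith [c.2, aτ.2]⟩
            (by linarith [abs_nonneg x, hz.1, b.1, c.2])).2.2.2.2).1)
        nlinarith [hs.2])
    have e : y + h - y = h := by ring
    rw [e] at m
    exact m
  have key : ∀ h, 0 < h → h < L / 8 → M * h ≤ 1 → ∀ x y t, |x| ≤ L / 4 → y ∈ Icc 0 (L / 8) →
      t ∈ Icc (T / 2) τ →
      0 ≤ u x (y + h) t - u x y t - h * (prof p (y + C₁ * (x ^ 2 + (T - t)) ^ γ) - C₂) := by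
    intro h h0 h1 hMh
    have sT : ∀ t ∈ Icc (T / 2) τ, 0 < T - t := fun t c => by linarith [c.2, aτ.2]
    have Epos : ∀ x y t, y ∈ Icc 0 (L / 8) → t ∈ Icc (T / 2) τ →
        0 < y + C₁ * (x ^ 2 + (T - t)) ^ γ := by
      intro x y t b c
      have := sT t c
      have h2 := b.1
      positivity
    have sb : ∀ y, y ∈ Icc 0 (L / 8) → y ∈ Icc 0 (L / 4) := fun y b => ⟨b.1, by linarith [b.2]⟩
    have sbh : ∀ y, y ∈ Icc 0 (L / 8) → y + h ∈ Icc 0 (L / 4) := fun y b =>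
      ⟨by linarith [b.1], by linarith [b.2]⟩
    apply comp0 (L / 4) (L / 8) (T / 2) τ
      (fun x y t => u x (y + h) t - u x y t - h * (prof p (y + C₁ * (x ^ 2 + (T - t)) ^ γ) - C₂))
      (fun x y t => pdx u x (y + h) t - pdx u x y t -
        h * (-(prof p (y + C₁ * (x ^ 2 + (T - t)) ^ γ)) ^ p *
          (C₁ * (2 * x * γ * (x ^ 2 + (T - t)) ^ (γ - 1)))))
      (fun x y t => pdy u x (y + h) t - pdy u x y t -
        h * (-(prof p (y + C₁ * (x ^ 2 + (T - t)) ^ γ)) ^ p))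
      (fun x y t => pdt u x (y + h) t - pdt u x y t -
        h * (-(prof p (y + C₁ * (x ^ 2 + (T - t)) ^ γ)) ^ p *
          (C₁ * (-1 * γ * (x ^ 2 + (T - t)) ^ (γ - 1)))))
      (fun x y t => pdxx u x (y + h) t - pdxx u x y t -
        h * (p * (prof p (y + C₁ * (x ^ 2 + (T - t)) ^ γ)) ^ (p - 1) *
              (prof p (y + C₁ * (x ^ 2 + (T - t)) ^ γ)) ^ p *
            (C₁ * (2 * x * γ * (x ^ 2 + (T - t)) ^ (γ - 1))) *
            (C₁ * (2 * x * γ * (x ^ 2 + (T - t)) ^ (γ - 1))) +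
          -(prof p (y + C₁ * (x ^ 2 + (T - t)) ^ γ)) ^ p *
            (C₁ * (2 * γ * (x ^ 2 + (T - t)) ^ (γ - 1) +
              2 * x * γ * (2 * x * (γ - 1) * (x ^ 2 + (T - t)) ^ (γ - 1 - 1))))))
      (fun x y t => pdyy u x (y + h) t - pdyy u x y t -
        h * (p * (prof p (y + C₁ * (x ^ 2 + (T - t)) ^ γ)) ^ (p - 1) *
              (prof p (y + C₁ * (x ^ 2 + (T - t)) ^ γ)) ^ p))
    · -- continuity
      intro x y t a b c
      have c1 := C21At.shift (u := u) (x := x) (y := y) (t := t) 0 h 0 (by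
        simpa using Rg x (y + h) t a (sbh y b) c)
      simp only [add_zero] at c1
      have c2 := (Rg x y t a (sb y b) c).cont
      have c3 : ContinuousAt (fun q : ℝ × ℝ × ℝ => q.2.1 + C₁ * (q.1 ^ 2 + (T - q.2.2)) ^ γ)
          (x, y, t) := by
        have : ContinuousAt (fun q : ℝ × ℝ × ℝ => (q.1 ^ 2 + (T - q.2.2)) ^ γ) (x, y, t) := by
          apply ContinuousAt.rpow_const (by fun_prop)
          right; linarith
        exact ContinuousAt.add (by fun_prop) (this.const_mul C₁)
      have c4 : ContinuousAt (fun q : ℝ × ℝ × ℝ =>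
          prof p (q.2.1 + C₁ * (q.1 ^ 2 + (T - q.2.2)) ^ γ)) (x, y, t) :=
        ContinuousAt.comp (g := prof p)
          (f := fun q : ℝ × ℝ × ℝ => q.2.1 + C₁ * (q.1 ^ 2 + (T - q.2.2)) ^ γ)
          (prof_deriv hp (Epos x y t b c)).continuousAt c3
      exact (c1.sub c2).sub ((c4.sub continuousAt_const).const_mul h)
    · -- boundary
      intro x y t a b c d
      have i1 := inc h h0 h1 x y t a b c
      have c' : t ∈ Ico (T / 2) T := ⟨c.1, by linarith [c.2, aτ.2]⟩
      have s0 := sT t c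
      have hp4 := (hpk x y t a (sb y b) c').2.2.2.1
      have fin : prof p (y + C₁ * (x ^ 2 + (T - t)) ^ γ) - C₂ ≤ pdy u x y t - 1 := by
        by_cases hy0 : y = 0
        · rw [hy0, zero_add]
          have := hbl x t a c'
          linarith
        · have hX : 0 < C₁ * (x ^ 2 + (T - t)) ^ γ := by positivity
          have : prof p (y + C₁ * (x ^ 2 + (T - t)) ^ γ) ≤
              prof p (L / 8) + prof p (C₁ * (T / 2) ^ γ) + prof p (C₁ * ((L / 4) ^ 2) ^ γ) := by
            rcases d with d | d | d | d
            · have : prof p (y + C₁ * (x ^ 2 + (T - t)) ^ γ) ≤ prof p (C₁ * ((L / 4) ^ 2) ^ γ) := by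
                apply prof_anti hp (by positivity)
                have : ((L / 4) ^ 2) ^ γ ≤ (x ^ 2 + (T - t)) ^ γ := by
                  apply Real.rpow_le_rpow (by positivity) _ (by linarith)
                  rw [← d, sq_abs]; linarith
                have := mul_le_mul_of_nonneg_left this hC₁.le
                linarith [b.1]
              linarith
            · exact absurd d hy0
            · have : prof p (y + C₁ * (x ^ 2 + (T - t)) ^ γ) ≤ prof p (L / 8) :=
                prof_anti hp (by positivity) (by linarith)
              linarith
            · have : prof p (y + C₁ * (x ^ 2 + (T - t)) ^ γ) ≤ prof p (C₁ * (T / 2) ^ γ) := by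
                apply prof_anti hp (by positivity)
                have : (T / 2) ^ γ ≤ (x ^ 2 + (T - t)) ^ γ := by
                  apply Real.rpow_le_rpow (by positivity) _ (by linarith)
                  rw [d]; nlinarith [sq_nonneg x]
                have := mul_le_mul_of_nonneg_left this hC₁.le
                linarith [b.1]
              linarith
          linarith
      have : (prof p (y + C₁ * (x ^ 2 + (T - t)) ^ γ) - C₂) * h ≤ (pdy u x y t - M * h) * h :=
        mul_le_mul_of_nonneg_right (by linarith) h0.le
      linarith
    · -- x derivative
      intro x y t a b c
      have b' := Ioo_subset_Icc_self b
      have c' := Ioc_subset_Icc_self c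
      have e1 := ((eta_dx γ (T - t) x (sT t c')).const_mul C₁).const_add y
      have e2 := (HasDerivAt.comp x (prof_deriv hp (Epos x y t b' c')) e1).sub_const C₂
      exact ((Rg x _ t a.le (sbh y b') c').dx.sub (Rg x y t a.le (sb y b') c').dx).sub
        (e2.const_mul h)
    · -- y derivative
      intro x y t a b c
      have b' := Ioo_subset_Icc_self b
      have c' := Ioc_subset_Icc_self c
      have e2 := ((prof_deriv hp (Epos x y t b' c')).comp_add_const y _).sub_const C₂
      exact (((Rg x _ t a.le (sbh y b') c').dy.comp_add_const y h).sub
        (Rg x y t a.le (sb y b') c').dy).sub (e2.const_mul h)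
    · -- t derivative
      intro x y t a b c
      have b' := Ioo_subset_Icc_self b
      have c' := Ioc_subset_Icc_self c
      have e1 := ((eta_dt γ T x t (by linarith [sT t c'])).const_mul C₁).const_add y
      have e2 := (HasDerivAt.comp t (prof_deriv hp (Epos x y t b' c')) e1).sub_const C₂
      exact ((Rg x _ t a.le (sbh y b') c').dt.sub (Rg x y t a.le (sb y b') c').dt).sub
        (e2.const_mul h)
    · -- xx derivative
      intro x y t a b c
      have b' := Ioo_subset_Icc_self b
      have c' := Ioc_subset_Icc_self c
      have e1 := ((eta_dx γ (T - t) x (sT t c')).const_mul C₁).const_add y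
      have e2 := HasDerivAt.comp x (prof_deriv2 hp (Epos x y t b' c')) e1
      have e3 := e2.mul ((eta_dxx γ (T - t) x (sT t c')).const_mul C₁)
      exact ((Rg x _ t a.le (sbh y b') c').dxx.sub (Rg x y t a.le (sb y b') c').dxx).sub
        (e3.const_mul h)
    · -- yy derivative
      intro x y t a b c
      have b' := Ioo_subset_Icc_self b
      have c' := Ioc_subset_Icc_self c
      have e2 := (prof_deriv2 hp (Epos x y t b' c')).comp_add_const y _
      exact (((Rg x _ t a.le (sbh y b') c').dyy.comp_add_const y h).sub
        (Rg x y t a.le (sb y b') c').dyy).sub (e2.const_mul h)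
    · -- the differential inequality
      intro x y t a b c hW hWx hWy
      have b' := Ioo_subset_Icc_self b
      have c' := Ioc_subset_Icc_self c
      have cT : t ∈ Ico (T / 2) T := ⟨c.1.le, by linarith [c.2, aτ.2]⟩
      have cT' : t ∈ Ioo 0 T := ⟨by linarith [c.1], by linarith [c.2, aτ.2]⟩
      have s0 := sT t c'
      have i1 := inc h h0 h1 x y t a.le b' c'
      obtain ⟨-, -, hw, hvA, -⟩ := hpk x y t a.le (sb y b') cT
      have hxw := hmon (x := x) (y := y) (t := t) (by linarith) ⟨b.1, by linarith [b.2]⟩ cT'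
      have pd1 := hsol.pde (x := x) (y := y) (t := t) (by linarith) ⟨b.1, by linarith [b.2]⟩ cT'
      have pd2 := hsol.pde (x := x) (y := y + h) (t := t) (by linarith)
        ⟨by linarith [b.1], by linarith [b.2]⟩ cT'
      have hFpos := prof_pos hp (Epos x y t b' c')
      have hxL : x ^ 2 + (T - t) ≤ L ^ 2 + T := by
        have : x ^ 2 ≤ (L / 4) ^ 2 := sq_le_sq' (by linarith [abs_lt.1 a]) (by linarith [abs_lt.1 a])
        have h2 : (L / 4) ^ 2 ≤ L ^ 2 := by
          have := sq_nonneg L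
          linarith [div_pow L 4 2]
        linarith [c.1]
      have eb := mul_le_mul_of_nonneg_left (eta_bound γ (T - t) x (L ^ 2 + T) hγ s0 hxL) hC₁.le
      rw [← hK] at eb
      have hR : 0 ≤ (x ^ 2 + (T - t)) ^ (γ - 1) := by positivity
      generalize prof p (y + C₁ * (x ^ 2 + (T - t)) ^ γ) = F at *
      set R := (x ^ 2 + (T - t)) ^ (γ - 1) with hRd
      generalize 2 * γ * R + 2 * x * γ * (2 * x * (γ - 1) * (x ^ 2 + (T - t)) ^ (γ - 1 - 1)) = Exx at *
      have hv1 : pdy u x y t - M * h < F - C₂ := by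
        refine lt_of_mul_lt_mul_right ?_ h0.le
        linarith
      have ak := alg_key (p := p) (F := F) (A := A) (c := K + 1) (K := K) (w := pdx u x y t)
        (v := pdy u x y t) hp (by linarith) (by linarith) (by linarith) hw (by linarith)
      have hFp : 0 < F ^ p := Real.rpow_pos_of_pos hFpos p
      have hFp1 : 0 < F ^ (p - 1) := Real.rpow_pos_of_pos hFpos _
      have g := grad_ineq p (pdx u x y t) (pdy u x y t) (h * (-F ^ p * (C₁ * (2 * x * γ * R))))
        (h * -F ^ p) hp
      have f1 : pdx u x y t + h * (-F ^ p * (C₁ * (2 * x * γ * R))) = pdx u x (y + h) t := by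
        linarith
      have f2 : pdy u x y t + h * -F ^ p = pdy u x (y + h) t := by linarith
      rw [f1, f2] at g
      unfold gradNorm at pd1 pd2
      rw [← pd1, ← pd2] at g
      have hG : 0 ≤ (pdx u x y t ^ 2 + pdy u x y t ^ 2) ^ (p / 2 - 1) :=
        Real.rpow_nonneg (by positivity) _
      set G := (pdx u x y t ^ 2 + pdy u x y t ^ 2) ^ (p / 2 - 1) with hGd
      have t1 : 0 ≤ p * G * (pdx u x y t * (h * (-F ^ p * (C₁ * (2 * x * γ * R))))) := by
        have : pdx u x y t * (h * (-F ^ p * (C₁ * (2 * x * γ * R)))) =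
          (h * F ^ p * C₁ * 2 * γ * R) * -(x * pdx u x y t) := by ring
        rw [this]
        apply mul_nonneg (by positivity)
        apply mul_nonneg (by positivity)
        linarith
      have t2 : 0 ≤ h * (p * F ^ (p - 1) * F ^ p * (C₁ * (2 * x * γ * R)) *
          (C₁ * (2 * x * γ * R))) := by
        have : h * (p * F ^ (p - 1) * F ^ p * (C₁ * (2 * x * γ * R)) * (C₁ * (2 * x * γ * R))) =
          h * (p * F ^ (p - 1) * F ^ p * (C₁ * (2 * x * γ * R)) ^ 2) := by ring
        rw [this]; positivity
      have t3 : 0 ≤ h * F ^ p * (p * F ^ (p - 1) - p * G * pdy u x y t - C₁ * (γ * R + Exx)) := by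
        apply mul_nonneg (by positivity)
        linarith
      have t4 : p * G * (pdx u x y t * (h * (-F ^ p * (C₁ * (2 * x * γ * R)))) +
          pdy u x y t * (h * -F ^ p)) =
          p * G * (pdx u x y t * (h * (-F ^ p * (C₁ * (2 * x * γ * R))))) -
            h * F ^ p * (p * G * pdy u x y t) := by ring
      rw [t4] at g
      have t5 : h * F ^ p * (p * F ^ (p - 1) - p * G * pdy u x y t - C₁ * (γ * R + Exx)) =
        h * (p * F ^ (p - 1) * F ^ p) - h * F ^ p * (p * G * pdy u x y t)
          - h * F ^ p * (C₁ * (γ * R)) - h * F ^ p * (C₁ * Exx) := by ring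
      rw [t5] at t3
      have t6 : h * (-F ^ p * (C₁ * (-1 * γ * R))) = h * F ^ p * (C₁ * (γ * R)) := by ring
      have t7 : h * (p * F ^ (p - 1) * F ^ p * (C₁ * (2 * x * γ * R)) * (C₁ * (2 * x * γ * R)) +
        -F ^ p * (C₁ * Exx)) = h * (p * F ^ (p - 1) * F ^ p * (C₁ * (2 * x * γ * R)) *
          (C₁ * (2 * x * γ * R))) - h * F ^ p * (C₁ * Exx) := by ring
      rw [t6, t7]
      linarith
  -- passage to the limit `h → 0`
  have hreg := Rg x y τ ax ⟨ay.1, by linarith [ay.2]⟩ ⟨aτ.1, le_rfl⟩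
  have h0 : 0 < min (L / 8) (1 / M) := by positivity
  have := right_test (fun s => u x s τ - (prof p (y + C₁ * (x ^ 2 + (T - τ)) ^ γ) - C₂) * s)
    (pdy u x y τ - (prof p (y + C₁ * (x ^ 2 + (T - τ)) ^ γ) - C₂) * 1) y
    (y + min (L / 8) (1 / M))
    (hreg.dy.sub ((hasDerivAt_id y).const_mul _)) (by linarith)
    (fun s hs => by
      have m1 := min_le_left (L / 8) (1 / M)
      have m2 := min_le_right (L / 8) (1 / M)
      have hMs : M * (s - y) ≤ 1 := by
        have : s - y ≤ 1 / M := by linarith [hs.2]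
        rw [le_div_iff₀ hM] at this
        linarith
      have k := key (s - y) (by linarith [hs.1]) (by linarith [hs.2]) hMs x y τ ax ay ⟨aτ.1, le_rfl⟩
      rw [add_sub_cancel] at k
      linarith)
  linarith

theorem limT {p L T : ℝ} (hp : 2 < p) (hL : 0 < L) (hT : 0 < T) {u : ℝ → ℝ → ℝ → ℝ}
    (hext : ExtC21 L T u) {C₁ C₂ : ℝ} (hC₁ : 0 < C₁)
    (h : ∀ x y t, |x| ≤ L / 4 → y ∈ Icc 0 (L / 8) → t ∈ Ico (T / 2) T →
      prof p (y + C₁ * (x ^ 2 + (T - t)) ^ ((p - 1) / (p - 2))) - C₂ ≤ pdy u x y t)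
    {x y : ℝ} (hx : |x| ≤ L / 4) (hy : y ∈ Icc 0 (L / 8)) (hxy : ¬(x = 0 ∧ y = 0)) :
    prof p (y + C₁ * |x| ^ (2 * (p - 1) / (p - 2))) - C₂ ≤ pdy u x y T := by
  have hp1 : 0 < p - 1 := by linarith
  have hp2 : 0 < p - 2 := by linarith
  have hγ : 0 < (p - 1) / (p - 2) := by positivity
  have e : |x| ^ (2 * (p - 1) / (p - 2)) = (x ^ 2 + (T - T)) ^ ((p - 1) / (p - 2)) := by
    rw [sub_self, add_zero, ← sq_abs, ← Real.rpow_natCast, ← Real.rpow_mul (abs_nonneg x)]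
    congr 1; push_cast; ring
  have hpos : 0 < y + C₁ * |x| ^ (2 * (p - 1) / (p - 2)) := by
    have hy0 := hy.1
    by_cases h0 : x = 0
    · have : 0 < y := lt_of_le_of_ne hy0 (fun e => hxy ⟨h0, e.symm⟩)
      positivity
    · have : 0 < |x| := abs_pos.2 h0
      positivity
  rw [e] at hpos ⊢
  have hr := hext (x := x) (y := y) (t := T) (by linarith) ⟨hy.1, by linarith [hy.2]⟩
    ⟨by linarith, le_rfl⟩ (fun c => hxy ⟨c.1, c.2.1⟩)
  have c1 : ContinuousAt (fun t => pdy u x y t) T :=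
    ContinuousAt.comp (g := fun q : ℝ × ℝ × ℝ => pdy u q.1 q.2.1 q.2.2)
      (f := fun t : ℝ => (x, y, t)) hr.2.2.2.2.2.2.2.2.1 (by fun_prop)
  have c2 : ContinuousAt (fun t : ℝ => y + C₁ * (x ^ 2 + (T - t)) ^ ((p - 1) / (p - 2))) T := by
    have : ContinuousAt (fun t : ℝ => (x ^ 2 + (T - t)) ^ ((p - 1) / (p - 2))) T := by
      apply ContinuousAt.rpow_const (by fun_prop)
      right; exact hγ.le
    exact ContinuousAt.add (by fun_prop) (this.const_mul C₁)
  have c3 : ContinuousAt (fun t : ℝ =>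
      prof p (y + C₁ * (x ^ 2 + (T - t)) ^ ((p - 1) / (p - 2))) - C₂) T :=
    (ContinuousAt.comp (g := prof p)
      (f := fun t : ℝ => y + C₁ * (x ^ 2 + (T - t)) ^ ((p - 1) / (p - 2)))
      (prof_deriv hp hpos).continuousAt c2).sub continuousAt_const
  refine le_of_tendsto_of_tendsto (c3.tendsto.mono_left (nhdsWithin_le_nhds (s := Iio T)))
    (c1.tendsto.mono_left nhdsWithin_le_nhds) ?_
  filter_upwards [Ioo_mem_nhdsLT (show T / 2 < T by linarith)] with t ht
  exact h x y t hx hy ⟨ht.1.le, ht.2⟩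

/-- Theorem 3.1: the lower estimate for the final gradient blow-up profile,
valid for every `p > 2`. Here `β = 1/(p-1)` and `d_p = β^β`. -/
theorem final_gbu_profile_lower (p L T : ℝ) (hp : 2 < p)
    (hL : 0 < L) (hT : 0 < T) (u : ℝ → ℝ → ℝ → ℝ)
    (hsol : ClassicalSolution p L T u) (hgbu : IsolatedGBU L T u)
    (hext : ExtC21 L T u) (hmon : MonCond L T u) :
    ∃ C₁ C₂ ρ : ℝ, 0 < C₁ ∧ 0 < C₂ ∧ 0 < ρ ∧ ρ < L ∧
      (∀ x y : ℝ, |x| ≤ ρ → y ∈ Icc (0:ℝ) ρ → ¬(x = 0 ∧ y = 0) →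
        ((1/(p-1) : ℝ) ^ (1/(p-1))) *
          (y + C₁ * |x| ^ (2*(p-1)/(p-2))) ^ (-(1/(p-1))) - C₂ ≤ pdy u x y T) ∧
      (∃ C₃ : ℝ, 0 < C₃ ∧ ∀ x : ℝ, 0 < |x| → |x| ≤ ρ →
        C₃ * |x| ^ (-(2/(p-2))) ≤ pdy u x 0 T) := by

  obtain ⟨C₁, hC₁, C₂, hC₂, h⟩ := interior_lower hp hL hT hsol hgbu hext hmon
  have hp1 : 0 < p - 1 := by linarith
  have hp2 : 0 < p - 2 := by linarith
  have hD := prof_pos hp hC₁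
  set D := prof p C₁ with hDd
  have key : ∀ {x y : ℝ}, |x| ≤ L / 4 → y ∈ Icc 0 (L / 8) → ¬(x = 0 ∧ y = 0) →
    prof p (y + C₁ * |x| ^ (2 * (p - 1) / (p - 2))) - C₂ ≤ pdy u x y T :=
      fun hx hy hxy => limT hp hL hT hext hC₁ h hx hy hxy
  set ρ := min (L / 8) ((2 * C₂ / D) ^ (-((p - 2) / 2))) with hρ
  have hρ0 : 0 < ρ := by positivity
  have hρL : ρ ≤ L / 8 := min_le_left _ _
  refine ⟨C₁, C₂, ρ, hC₁, hC₂, hρ0, by linarith, ?_, D / 2, by positivity, ?_⟩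
  · intro x y hx hy hxy
    exact key (by linarith) ⟨hy.1, by linarith [hy.2]⟩ hxy
  · intro x hx0 hx
    have k := key (x := x) (y := 0) (by linarith) ⟨le_rfl, by positivity⟩
      (fun c => by rw [c.1, abs_zero] at hx0; exact lt_irrefl _ hx0)
    have e : prof p (0 + C₁ * |x| ^ (2 * (p - 1) / (p - 2))) = D * |x| ^ (-(2 / (p - 2))) := by
      rw [hDd, zero_add]
      unfold prof
      rw [Real.mul_rpow hC₁.le (by positivity), ← Real.rpow_mul hx0.le, mul_assoc]
      congr 3
      field_simp
    rw [e] at k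
    have hb : 2 * C₂ / D ≤ |x| ^ (-(2 / (p - 2))) := by
      have h1 : |x| ≤ (2 * C₂ / D) ^ (-((p - 2) / 2)) := hx.trans (min_le_right _ _)
      have h2 := Real.rpow_le_rpow_of_nonpos hx0 h1 (z := -(2 / (p - 2)))
        (by have : 0 < 2 / (p - 2) := by positivity
            linarith)
      rw [← Real.rpow_mul (by positivity)] at h2
      have h3 : -((p - 2) / 2) * -(2 / (p - 2)) = 1 := by field_simp
      rwa [h3, Real.rpow_one] at h2
    rw [div_le_iff₀ hD] at hb
    linarith
end
end

section
/- Let p>2, let u be a nonnegative classical solution of u_t−Δu=|∇u|^p in Q_T with u=0 on Γ_T, having an isolated gradient blowup point at (0,0,T) and satisfying the monotonicity condition x·u_x≤0 in Q_T. Then there exists a constant C>0 (possibly depending on u) such that |u_x(x,y,t)| ≤ C|x| for all (x,y,t) in Q̃:=(ω̄'×[T/2,T])∖{(0,0,T)}. -/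
open Real Set Filter MeasureTheory

noncomputable section

theorem fd_right (g : ℝ → ℝ) (x0 b c : ℝ) (hb : x0 < b)
    (hmin : ∀ x ∈ Icc x0 b, g x0 ≤ g x) (hd : HasDerivAt g c x0) : 0 ≤ c := by
  have h1 := (hasDerivWithinAt_iff_tendsto_slope' (notMem_Ioi.2 le_rfl)).1 (hd.hasDerivWithinAt (s := Ioi x0))
  refine ge_of_tendsto h1 ?_
  filter_upwards [Ioo_mem_nhdsGT hb] with x hx
  rw [slope_def_field]
  exact div_nonneg (sub_nonneg.2 (hmin x ⟨hx.1.le, hx.2.le⟩)) (sub_nonneg.2 hx.1.le)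

theorem fd_left (g : ℝ → ℝ) (x0 b c : ℝ) (hb : b < x0)
    (hmin : ∀ x ∈ Icc b x0, g x0 ≤ g x) (hd : HasDerivAt g c x0) : c ≤ 0 := by
  have h1 := (hasDerivWithinAt_iff_tendsto_slope' (notMem_Iio.2 le_rfl)).1 (hd.hasDerivWithinAt (s := Iio x0))
  refine le_of_tendsto h1 ?_
  filter_upwards [Ioo_mem_nhdsLT hb] with x hx
  rw [slope_def_field]
  exact div_nonpos_of_nonneg_of_nonpos (sub_nonneg.2 (hmin x ⟨hx.1.le, hx.2.le⟩)) (sub_nonpos.2 hx.2.le)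

theorem sd_right (g g' : ℝ → ℝ) (x0 b c : ℝ) (hb : x0 < b)
    (hmin : ∀ x ∈ Icc x0 b, g x0 ≤ g x)
    (hd : ∀ x ∈ Icc x0 b, HasDerivAt g (g' x) x)
    (hz : g' x0 = 0) (hd2 : HasDerivAt g' c x0) : 0 ≤ c := by
  by_contra hc
  push Not at hc
  have h1 := (hasDerivWithinAt_iff_tendsto_slope' (notMem_Ioi.2 le_rfl)).1 (hd2.hasDerivWithinAt (s := Ioi x0))
  have h2 := (h1.eventually (gt_mem_nhds hc)).and (Ioo_mem_nhdsGT hb)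
  obtain ⟨d, hd0, hdd⟩ := (mem_nhdsGT_iff_exists_Ioo_subset).1 h2
  have hd0' : x0 < d := hd0
  have key : ∀ x ∈ Ioo x0 d, g' x < 0 ∧ x < b := by
    intro x hx
    obtain ⟨h3, h4⟩ := hdd hx
    rw [slope_def_field, hz, sub_zero] at h3
    refine ⟨?_, h4.2⟩
    by_contra h5
    push Not at h5
    exact absurd h3 (not_lt.2 (div_nonneg h5 (sub_nonneg.2 hx.1.le)))
  set m := (x0 + d) / 2 with hm
  have hmx : x0 < m := by rw [hm]; linarith
  have hmd : m < d := by rw [hm]; linarith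
  have hmb := (key m ⟨hmx, hmd⟩).2
  obtain ⟨z, hz1, hz2⟩ := exists_hasDerivAt_eq_slope g g' hmx
    (fun x hx => (hd x ⟨hx.1, hx.2.trans hmb.le⟩).continuousAt.continuousWithinAt)
    (fun x hx => hd x ⟨hx.1.le, hx.2.le.trans hmb.le⟩)
  have := (key z ⟨hz1.1, hz1.2.trans hmd⟩).1
  rw [hz2] at this
  exact absurd this (not_lt.2 (div_nonneg (sub_nonneg.2 (hmin m ⟨hmx.le, hmb.le⟩)) (sub_nonneg.2 hmx.le)))

/-- `fx 0 = 0`, `fxx ≥ -K` gives `f + K x^2/2` nondecreasing. -/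
theorem mono_of_second (f fx fxx : ℝ → ℝ) (a K : ℝ)
    (h1 : ∀ x ∈ Icc 0 a, HasDerivAt f (fx x) x)
    (h2 : ∀ x ∈ Icc 0 a, HasDerivAt fx (fxx x) x)
    (h0 : fx 0 = 0) (hK : ∀ x ∈ Icc 0 a, -K ≤ fxx x)
    (x1 x2 : ℝ) (hx2 : 0 ≤ x2) (h12 : x2 ≤ x1) (hx1 : x1 ≤ a) :
    0 ≤ f x1 - f x2 + K / 2 * (x1 ^ 2 - x2 ^ 2) := by
  have e1 : ∀ x ∈ Icc 0 a, HasDerivAt (fun s => fx s + K * s) (fxx x + K) x := by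
    intro x hx
    exact ((h2 x hx).add ((hasDerivAt_id x).const_mul K)).congr_deriv (by norm_num <;> ring)
  have e2 : ∀ x ∈ Icc 0 a, HasDerivAt (fun s => f s + K / 2 * s ^ 2) (fx x + K * x) x := by
    intro x hx
    exact ((h1 x hx).add ((hasDerivAt_pow 2 x).const_mul (K / 2))).congr_deriv (by norm_num <;> ring)
  have m1 : MonotoneOn (fun s => fx s + K * s) (Icc 0 a) := by
    refine monotoneOn_of_hasDerivWithinAt_nonneg (f' := fun x => fxx x + K) (convex_Icc 0 a)
      (fun x hx => (e1 x hx).continuousAt.continuousWithinAt)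
      (fun x hx => (e1 x (interior_subset hx)).hasDerivWithinAt) ?_
    intro x hx
    have := hK x (interior_subset hx)
    linarith
  have ha : 0 ≤ a := hx2.trans (h12.trans hx1)
  have m2 : MonotoneOn (fun s => f s + K / 2 * s ^ 2) (Icc 0 a) := by
    refine monotoneOn_of_hasDerivWithinAt_nonneg (f' := fun x => fx x + K * x) (convex_Icc 0 a)
      (fun x hx => (e2 x hx).continuousAt.continuousWithinAt)
      (fun x hx => (e2 x (interior_subset hx)).hasDerivWithinAt) ?_
    intro x hx
    have hx' := interior_subset hx
    have := m1 ⟨le_rfl, ha⟩ hx' hx'.1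
    simp only [h0] at this ⊢; linarith
  have := m2 ⟨hx2, h12.trans hx1⟩ ⟨hx2.trans h12, hx1⟩ h12
  linarith

theorem core (f fx fxx fy fyy ft : ℝ → ℝ → ℝ → ℝ) (p a K t0 τ : ℝ) (hp : 2 < p)
    (hK0 : 0 < K)
    (hfx : ∀ x ∈ Icc 0 a, ∀ y ∈ Icc 0 a, ∀ t ∈ Icc t0 τ, HasDerivAt (fun s => f s y t) (fx x y t) x)
    (hfxx : ∀ x ∈ Icc 0 a, ∀ y ∈ Icc 0 a, ∀ t ∈ Icc t0 τ, HasDerivAt (fun s => fx s y t) (fxx x y t) x)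
    (hfy : ∀ x ∈ Icc 0 a, ∀ y ∈ Icc 0 a, ∀ t ∈ Icc t0 τ, HasDerivAt (fun s => f x s t) (fy x y t) y)
    (hfyy : ∀ x ∈ Icc 0 a, ∀ y ∈ Icc 0 a, ∀ t ∈ Icc t0 τ, HasDerivAt (fun s => fy x s t) (fyy x y t) y)
    (hft : ∀ x ∈ Icc 0 a, ∀ y ∈ Icc 0 a, ∀ t ∈ Icc t0 τ, HasDerivAt (fun s => f x y s) (ft x y t) t)
    (hc : ContinuousOn (fun q : ℝ × ℝ × ℝ => f q.1 q.2.1 q.2.2) (Icc 0 a ×ˢ Icc 0 a ×ˢ Icc t0 τ))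
    (pde : ∀ x ∈ Icc 0 a, ∀ y ∈ Ioo 0 a, ∀ t ∈ Icc t0 τ,
      ft x y t - (fxx x y t + fyy x y t) = Real.sqrt ((fx x y t) ^ 2 + (fy x y t) ^ 2) ^ p)
    (bc : ∀ x ∈ Icc 0 a, ∀ t ∈ Icc t0 τ, f x 0 t = 0)
    (h0 : ∀ y ∈ Ioc 0 a, ∀ t ∈ Icc t0 τ, fx 0 y t = 0)
    (hKa : ∀ x ∈ Icc 0 a, ∀ t ∈ Icc t0 τ, -K ≤ fxx x a t)
    (hKt : ∀ x ∈ Icc 0 a, ∀ y ∈ Icc 0 a, -K ≤ fxx x y t0)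
    (hKx : ∀ y ∈ Icc 0 a, ∀ t ∈ Icc t0 τ, 0 < fx a y t + K * a)
    (x1 x2 y t : ℝ) (hx2 : 0 ≤ x2) (h12 : x2 ≤ x1) (hx1 : x1 ≤ a) (hy : y ∈ Icc 0 a)
    (ht : t ∈ Icc t0 τ) :
    0 ≤ f x1 y t - f x2 y t + K / 2 * (x1 ^ 2 - x2 ^ 2) := by
  have sqle : ∀ r s : ℝ, 0 ≤ s → s ≤ r → 0 ≤ K / 2 * (r ^ 2 - s ^ 2) := by
    intro r s hs hr
    have : s ^ 2 ≤ r ^ 2 := by gcongr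
    have := sub_nonneg.2 this
    positivity
  by_contra hneg
  push Not at hneg
  set F0 := f x1 y t - f x2 y t + K / 2 * (x1 ^ 2 - x2 ^ 2) with hF0
  obtain ⟨ε, hε, hεF⟩ : ∃ ε : ℝ, 0 < ε ∧ F0 + ε * (t - t0) < 0 := by
    have hh : 0 ≤ t - t0 := sub_nonneg.2 ht.1
    refine ⟨-F0 / (2 * (t - t0 + 1)), by have : 0 < -F0 := by linarith
                                         positivity, ?_⟩
    have : -F0 / (2 * (t - t0 + 1)) * (t - t0) ≤ -F0 / 2 := by
      rw [div_mul_eq_mul_div, div_le_div_iff₀ (by positivity) (by positivity)]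
      nlinarith
    linarith
  let S : Set (ℝ × ℝ × ℝ × ℝ) := (Icc 0 a ×ˢ Icc 0 a ×ˢ Icc 0 a ×ˢ Icc t0 τ) ∩ {q | q.2.1 ≤ q.1}
  have hS : IsCompact S := by
    refine IsCompact.inter_right ?_ (isClosed_le (by fun_prop) (by fun_prop))
    exact isCompact_Icc.prod (isCompact_Icc.prod (isCompact_Icc.prod isCompact_Icc))
  let F : ℝ × ℝ × ℝ × ℝ → ℝ := fun q => f q.1 q.2.2.1 q.2.2.2 - f q.2.1 q.2.2.1 q.2.2.2
    + K / 2 * (q.1 ^ 2 - q.2.1 ^ 2) + ε * (q.2.2.2 - t0)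
  have hFc : ContinuousOn F S := by
    have c1 : ContinuousOn (fun q : ℝ × ℝ × ℝ × ℝ => f q.1 q.2.2.1 q.2.2.2) S :=
      hc.comp (f := fun q : ℝ × ℝ × ℝ × ℝ => (q.1, q.2.2.1, q.2.2.2)) (by fun_prop)
        (fun q hq => ⟨hq.1.1, hq.1.2.2⟩)
    have c2 : ContinuousOn (fun q : ℝ × ℝ × ℝ × ℝ => f q.2.1 q.2.2.1 q.2.2.2) S :=
      hc.comp (f := fun q : ℝ × ℝ × ℝ × ℝ => (q.2.1, q.2.2.1, q.2.2.2)) (by fun_prop)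
        (fun q hq => ⟨hq.1.2.1, hq.1.2.2⟩)
    exact ((c1.sub c2).add (by fun_prop)).add (by fun_prop)
  have hmem : (x1, x2, y, t) ∈ S :=
    ⟨⟨⟨hx2.trans h12, hx1⟩, ⟨hx2, h12.trans hx1⟩, hy, ht⟩, h12⟩
  obtain ⟨⟨X, Z, Y, R⟩, ⟨⟨hX, hZ, hY, hR⟩, hZX⟩, hmin⟩ := hS.exists_isMinOn ⟨_, hmem⟩ hFc
  have hFneg : F (X, Z, Y, R) < 0 := lt_of_le_of_lt (hmin hmem) hεF
  have hmin' : ∀ x z y t, x ∈ Icc 0 a → z ∈ Icc 0 a → y ∈ Icc 0 a → t ∈ Icc t0 τ → z ≤ x →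
      F (X, Z, Y, R) ≤ F (x, z, y, t) := fun x z y t h1 h2 h3 h4 h5 =>
    hmin (show (x, z, y, t) ∈ S from ⟨⟨h1, h2, h3, h4⟩, h5⟩)
  clear hmin hmem
  simp only [F] at hFneg hmin'
  dsimp only at hX hZ hY hR
  change Z ≤ X at hZX
  have hεR : 0 ≤ ε * (R - t0) := mul_nonneg hε.le (sub_nonneg.2 hR.1)
  -- exclude the parabolic boundary
  have hY0 : 0 < Y := by
    rcases hY.1.eq_or_lt with h | h
    · subst h
      rw [bc X hX R hR, bc Z hZ R hR] at hFneg
      have := sqle X Z hZ.1 hZX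
      linarith
    · exact h
  have hYa : Y < a := by
    rcases hY.2.eq_or_lt with h | h
    · subst h
      have := mono_of_second (fun x => f x Y R) (fun x => fx x Y R) (fun x => fxx x Y R) Y K
        (fun x hx => hfx x hx Y hY R hR) (fun x hx => hfxx x hx Y hY R hR)
        (h0 Y ⟨hY0, le_rfl⟩ R hR) (fun x hx => hKa x hx R hR) X Z hZ.1 hZX hX.2
      linarith
    · exact h
  have hRt : t0 < R := by
    rcases hR.1.eq_or_lt with h | h
    · subst h
      have := mono_of_second (fun x => f x Y t0) (fun x => fx x Y t0) (fun x => fxx x Y t0) a K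
        (fun x hx => hfx x hx Y hY t0 hR) (fun x hx => hfxx x hx Y hY t0 hR)
        (h0 Y ⟨hY0, hYa.le⟩ t0 hR) (fun x hx => hKt x hx Y hY) X Z hZ.1 hZX hX.2
      linarith
    · exact h
  have hZX' : Z < X := by
    rcases hZX.eq_or_lt with h | h
    · subst h
      simp at hFneg
      linarith
    · exact h
  -- first variable
  have dX : ∀ x ∈ Icc 0 a, HasDerivAt (fun s => f s Y R - f Z Y R + K / 2 * (s ^ 2 - Z ^ 2)
      + ε * (R - t0)) (fx x Y R + K * x) x := by
    intro x hx
    exact ((((hfx x hx Y hY R hR).sub_const (f Z Y R)).add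
      (((hasDerivAt_pow 2 x).sub_const (Z ^ 2)).const_mul (K / 2))).add_const (ε * (R - t0))).congr_deriv (by norm_num <;> ring)
  have leX : fx X Y R + K * X ≤ 0 :=
    fd_left _ X Z _ hZX' (fun x hx => hmin' x Z Y R ⟨hZ.1.trans hx.1, hx.2.trans hX.2⟩ hZ hY hR hx.1)
      (dX X hX)
  have hXa : X < a := by
    rcases hX.2.eq_or_lt with h | h
    · subst h
      have := hKx Y hY R hR
      linarith
    · exact h
  have minX : ∀ x ∈ Icc X a, f X Y R - f Z Y R + K / 2 * (X ^ 2 - Z ^ 2) + ε * (R - t0) ≤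
      f x Y R - f Z Y R + K / 2 * (x ^ 2 - Z ^ 2) + ε * (R - t0) :=
    fun x hx => hmin' x Z Y R ⟨hX.1.trans hx.1, hx.2⟩ hZ hY hR (hZX.trans hx.1)
  have eqX : fx X Y R + K * X = 0 := le_antisymm leX (fd_right _ X a _ hXa minX (dX X hX))
  have sX : 0 ≤ fxx X Y R + K := by
    refine sd_right _ (fun x => fx x Y R + K * x) X a _ hXa minX
      (fun x hx => dX x ⟨hX.1.trans hx.1, hx.2⟩) eqX ?_
    exact ((hfxx X hX Y hY R hR).add ((hasDerivAt_id X).const_mul K)).congr_deriv (by norm_num <;> ring)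
  -- second variable
  have dZ : ∀ x ∈ Icc 0 a, HasDerivAt (fun s => f X Y R - f s Y R + K / 2 * (X ^ 2 - s ^ 2)
      + ε * (R - t0)) (-(fx x Y R + K * x)) x := by
    intro x hx
    exact ((((hfx x hx Y hY R hR).const_sub (f X Y R)).add
      (((hasDerivAt_pow 2 x).const_sub (X ^ 2)).const_mul (K / 2))).add_const (ε * (R - t0))).congr_deriv (by norm_num <;> ring)
  have minZ : ∀ x ∈ Icc Z X, f X Y R - f Z Y R + K / 2 * (X ^ 2 - Z ^ 2) + ε * (R - t0) ≤
      f X Y R - f x Y R + K / 2 * (X ^ 2 - x ^ 2) + ε * (R - t0) :=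
    fun x hx => hmin' X x Y R hX ⟨hZ.1.trans hx.1, hx.2.trans hX.2⟩ hY hR hx.2
  have eqZ : -(fx Z Y R + K * Z) = 0 := by
    rcases hZ.1.eq_or_lt with h | h
    · rw [← h, h0 Y ⟨hY0, hYa.le⟩ R hR]; simp
    · refine le_antisymm ?_ (fd_right _ Z X _ hZX' minZ (dZ Z hZ))
      exact fd_left _ Z 0 _ h (fun x hx => hmin' X x Y R hX ⟨hx.1, hx.2.trans hZ.2⟩ hY hR
        (hx.2.trans hZX)) (dZ Z hZ)
  have sZ : 0 ≤ -(fxx Z Y R + K) := by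
    refine sd_right _ (fun x => -(fx x Y R + K * x)) Z X _ hZX' minZ
      (fun x hx => dZ x ⟨hZ.1.trans hx.1, hx.2.trans hX.2⟩) eqZ ?_
    exact (((hfxx Z hZ Y hY R hR).add ((hasDerivAt_id Z).const_mul K)).neg).congr_deriv (by norm_num <;> ring)
  -- y variable
  have dY : ∀ x ∈ Icc 0 a, HasDerivAt (fun s => f X s R - f Z s R + K / 2 * (X ^ 2 - Z ^ 2)
      + ε * (R - t0)) (fy X x R - fy Z x R) x := by
    intro x hx
    exact (((hfy X hX x hx R hR).sub (hfy Z hZ x hx R hR)).add_const _).add_const _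
  have minY : ∀ x ∈ Icc Y a, f X Y R - f Z Y R + K / 2 * (X ^ 2 - Z ^ 2) + ε * (R - t0) ≤
      f X x R - f Z x R + K / 2 * (X ^ 2 - Z ^ 2) + ε * (R - t0) :=
    fun x hx => hmin' X Z x R hX hZ ⟨hY.1.trans hx.1, hx.2⟩ hR hZX
  have eqY : fy X Y R - fy Z Y R = 0 := by
    refine le_antisymm ?_ (fd_right _ Y a _ hYa minY (dY Y hY))
    exact fd_left _ Y 0 _ hY0 (fun x hx => hmin' X Z x R hX hZ ⟨hx.1, hx.2.trans hY.2⟩ hR hZX)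
      (dY Y hY)
  have sY : 0 ≤ fyy X Y R - fyy Z Y R := by
    exact sd_right _ (fun x => fy X x R - fy Z x R) Y a _ hYa minY
      (fun x hx => dY x ⟨hY.1.trans hx.1, hx.2⟩) eqY
      ((hfyy X hX Y hY R hR).sub (hfyy Z hZ Y hY R hR))
  -- t variable
  have dT : HasDerivAt (fun s => f X Y s - f Z Y s + K / 2 * (X ^ 2 - Z ^ 2)
      + ε * (s - t0)) (ft X Y R - ft Z Y R + ε) R := by
    have := (((hft X hX Y hY R hR).sub (hft Z hZ Y hY R hR)).add_const (K / 2 * (X ^ 2 - Z ^ 2))).add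
      (((hasDerivAt_id R).sub_const t0).const_mul ε)
    exact this.congr_deriv (by norm_num)
  have leT : ft X Y R - ft Z Y R + ε ≤ 0 :=
    fd_left _ R t0 _ hRt (fun x hx => hmin' X Z Y x hX hZ hY ⟨hx.1, hx.2.trans hR.2⟩ hZX) dT
  have pX := pde X hX Y ⟨hY0, hYa⟩ R hR
  have pZ := pde Z hZ Y ⟨hY0, hYa⟩ R hR
  have e1 : fx X Y R = -(K * X) := by linarith
  have e2 : fx Z Y R = -(K * Z) := by linarith
  have e3 : fy X Y R = fy Z Y R := by linarith
  have hpow : Real.sqrt ((fx Z Y R) ^ 2 + (fy Z Y R) ^ 2) ^ p ≤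
      Real.sqrt ((fx X Y R) ^ 2 + (fy X Y R) ^ 2) ^ p := by
    refine Real.rpow_le_rpow (Real.sqrt_nonneg _) (Real.sqrt_le_sqrt ?_) (by linarith)
    rw [e1, e2, e3, neg_sq, neg_sq]
    have := hZ.1
    gcongr
  linarith

theorem pdx_zero_bdry (p L T : ℝ) (u : ℝ → ℝ → ℝ → ℝ)
    (hsol : ClassicalSolution p L T u) (x t : ℝ) (hx : |x| < L) (ht : t ∈ Ioo 0 T) :
    pdx u x 0 t = 0 := by
  unfold pdx
  have : (fun s => u s 0 t) =ᶠ[nhds x] fun _ => (0:ℝ) := by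
    have hx' := abs_lt.1 hx
    filter_upwards [Ioo_mem_nhds hx'.1 hx'.2] with s hs
    exact hsol.bc (abs_lt.2 hs) ht
  rw [this.deriv_eq]; simp

theorem pdx_zero_axis (p L T : ℝ) (hL : 0 < L) (u : ℝ → ℝ → ℝ → ℝ)
    (hsol : ClassicalSolution p L T u) (hmon : MonCond L T u)
    (y t : ℝ) (hy : y ∈ Ioo 0 L) (ht : t ∈ Ioo 0 T) :
    pdx u 0 y t = 0 := by
  have hs := hsol.smooth (x := 0) (by simpa using hL.le) ⟨hy.1.le, hy.2.le⟩ ht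
  have hc : ContinuousAt (fun s => pdx u s y t) 0 := hs.2.2.2.1.continuousAt
  apply le_antisymm
  · refine le_of_tendsto (hc.tendsto.mono_left (nhdsWithin_le_nhds (s := Ioi 0))) ?_
    filter_upwards [Ioo_mem_nhdsGT hL] with s hs
    have := hmon (x := s) (abs_lt.2 ⟨by linarith [hs.1], hs.2⟩) hy ht
    have h1 := hs.1
    by_contra h
    push Not at h
    nlinarith [mul_pos h1 h]
  · refine ge_of_tendsto (hc.tendsto.mono_left (nhdsWithin_le_nhds (s := Iio 0))) ?_
    filter_upwards [Ioo_mem_nhdsLT (neg_lt_zero.2 hL)] with s hs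
    have := hmon (x := s) (abs_lt.2 ⟨hs.1, by linarith [hs.2]⟩) hy ht
    have h1 := hs.2
    by_contra h
    push Not at h
    nlinarith [mul_pos_of_neg_of_neg h1 h]

theorem side (p L T : ℝ) (hp : 2 < p) (hL : 0 < L) (hT : 0 < T)
    (u : ℝ → ℝ → ℝ → ℝ)
    (hsol : ClassicalSolution p L T u)
    (hext : ExtC21 L T u) (hmon : MonCond L T u) (σ : ℝ) (hσ : σ ^ 2 = 1) :
    ∃ K : ℝ, 0 < K ∧ ∀ x ∈ Icc (0:ℝ) (L/2), ∀ y ∈ Icc (0:ℝ) (L/2), ∀ t ∈ Ico (T/2) T,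
      -(K * x) ≤ σ * pdx u (σ * x) y t := by
  have hσa : |σ| = 1 := by rwa [← sq_abs, pow_eq_one_iff_of_nonneg (abs_nonneg _) two_ne_zero] at hσ
  have habs : ∀ x ∈ Icc (0:ℝ) (L/2), |σ * x| ≤ L / 2 := by
    intro x hx; rw [abs_mul, hσa, one_mul, abs_of_nonneg hx.1]; exact hx.2
  have ha : 0 < L / 2 := by positivity
  obtain ⟨M1, hM1⟩ : ∃ M, ∀ q ∈ Icc (-(L/2)) (L/2) ×ˢ {L/2} ×ˢ Icc (T/2) T,
      ‖(fun q : ℝ × ℝ × ℝ => pdxx u q.1 q.2.1 q.2.2) q‖ ≤ M := by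
    refine (isCompact_Icc.prod (isCompact_singleton.prod isCompact_Icc)).exists_bound_of_continuousOn ?_
    rintro ⟨x, y, t⟩ ⟨h1, h2, h3⟩
    have h2' : y = L / 2 := h2
    have := hext (x := x) (y := y) (t := t) (abs_le.2 h1) (by rw [h2']; exact ⟨ha.le, le_rfl⟩) h3
      (by rintro ⟨-, h, -⟩; linarith)
    exact this.2.2.2.2.2.2.2.2.2.2.1.continuousWithinAt
  obtain ⟨M2, hM2⟩ : ∃ M, ∀ q ∈ Icc (-(L/2)) (L/2) ×ˢ Icc 0 (L/2) ×ˢ {T/2},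
      ‖(fun q : ℝ × ℝ × ℝ => pdxx u q.1 q.2.1 q.2.2) q‖ ≤ M := by
    refine (isCompact_Icc.prod (isCompact_Icc.prod isCompact_singleton)).exists_bound_of_continuousOn ?_
    rintro ⟨x, y, t⟩ ⟨h1, h2, h3⟩
    have h3' : t = T / 2 := h3
    have := hext (x := x) (y := y) (t := t) (abs_le.2 h1) h2 (by rw [h3']; constructor <;> linarith)
      (by rintro ⟨-, -, h⟩; linarith)
    exact this.2.2.2.2.2.2.2.2.2.2.1.continuousWithinAt
  obtain ⟨M3, hM3⟩ : ∃ M, ∀ q ∈ {σ * (L/2)} ×ˢ Icc 0 (L/2) ×ˢ Icc (T/2) T,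
      ‖(fun q : ℝ × ℝ × ℝ => pdx u q.1 q.2.1 q.2.2) q‖ ≤ M := by
    refine (isCompact_singleton.prod (isCompact_Icc.prod isCompact_Icc)).exists_bound_of_continuousOn ?_
    rintro ⟨x, y, t⟩ ⟨h1, h2, h3⟩
    have h1' : x = σ * (L / 2) := h1
    have hx : |x| ≤ L / 2 := by rw [h1']; exact habs _ ⟨ha.le, le_rfl⟩
    have := hext (x := x) (y := y) (t := t) hx h2 h3
      (by
        rintro ⟨h, -, -⟩
        rw [h1'] at h
        have : |σ * (L/2)| = 0 := by rw [h, abs_zero]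
        rw [abs_mul, hσa, one_mul, abs_of_pos ha] at this
        linarith)
    exact this.2.2.2.2.2.2.2.1.continuousWithinAt
  set K := |M1| + |M2| + (|M3| + 1) / (L / 2) with hK
  have hK0 : 0 < K := by positivity
  have hKM1 : |M1| ≤ K := by
    have : 0 ≤ |M2| + (|M3| + 1) / (L / 2) := by positivity
    linarith
  have hKM2 : |M2| ≤ K := by
    have : 0 ≤ |M1| + (|M3| + 1) / (L / 2) := by positivity
    linarith
  have hKM3 : |M3| + 1 ≤ K * (L / 2) := by
    have h1 : (|M3| + 1) / (L / 2) ≤ K := by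
      have : 0 ≤ |M1| + |M2| := by positivity
      linarith
    rwa [div_le_iff₀ ha] at h1
  have hbd : ∀ y ∈ Icc 0 (L/2), ∀ t ∈ Ico (T/2) T, 0 < σ * pdx u (σ * (L/2)) y t + K * (L/2) := by
    intro y hy t ht
    have h1 := hM3 (σ * (L/2), y, t) ⟨rfl, hy, ht.1, ht.2.le⟩
    simp only [Real.norm_eq_abs] at h1
    have h2 : |σ * pdx u (σ * (L/2)) y t| ≤ M3 := by rwa [abs_mul, hσa, one_mul]
    have := (abs_le.1 h2).1
    have := le_abs_self M3
    linarith
  refine ⟨K, hK0, ?_⟩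
  intro x hx y hy t ht
  have hC : ∀ x ∈ Icc (0:ℝ) (L/2), ∀ y ∈ Icc (0:ℝ) (L/2), ∀ s ∈ Icc (T/2) t, C21At u (σ * x) y s := by
    intro x hx y hy s hs
    exact hext (habs x hx) hy ⟨hs.1, hs.2.trans ht.2.le⟩
      (by rintro ⟨-, -, h⟩; linarith [hs.2, ht.2])
  have htI : ∀ s ∈ Icc (T/2) t, s ∈ Ioo 0 T := fun s hs =>
    ⟨by linarith [hs.1], by linarith [hs.2, ht.2]⟩
  have hlin : ∀ x : ℝ, HasDerivAt (fun s => σ * s) σ x := fun x =>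
    ((hasDerivAt_id x).const_mul σ).congr_deriv (mul_one σ)
  have hfx : ∀ x ∈ Icc 0 (L/2), ∀ y ∈ Icc 0 (L/2), ∀ s ∈ Icc (T/2) t,
      HasDerivAt (fun r => u (σ * r) y s) (σ * pdx u (σ * x) y s) x := by
    intro x hx y hy s hs
    have h1 : HasDerivAt (fun r => u r y s) (pdx u (σ * x) y s) (σ * x) :=
      (hC x hx y hy s hs).1.hasDerivAt
    exact (h1.comp x (hlin x)).congr_deriv (mul_comm _ _)
  have hmono := core (fun x y t => u (σ * x) y t) (fun x y t => σ * pdx u (σ * x) y t)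
    (fun x y t => pdxx u (σ * x) y t) (fun x y t => pdy u (σ * x) y t)
    (fun x y t => pdyy u (σ * x) y t) (fun x y t => pdt u (σ * x) y t) p (L/2) K (T/2) t hp hK0
    hfx
    (by
      intro x hx y hy s hs
      have h1 : HasDerivAt (fun r => pdx u r y s) (pdxx u (σ * x) y s) (σ * x) :=
        (hC x hx y hy s hs).2.2.2.1.hasDerivAt
      refine ((h1.comp x (hlin x)).const_mul σ).congr_deriv ?_
      linear_combination (pdxx u (σ * x) y s) * hσ)
    (fun x hx y hy s hs => (hC x hx y hy s hs).2.1.hasDerivAt)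
    (fun x hx y hy s hs => (hC x hx y hy s hs).2.2.2.2.1.hasDerivAt)
    (fun x hx y hy s hs => (hC x hx y hy s hs).2.2.1.hasDerivAt)
    (by
      rintro ⟨x, y, s⟩ ⟨h1, h2, h3⟩
      have h4 := (hC x h1 y h2 s h3).2.2.2.2.2.2.1
      have h5 : ContinuousAt (fun q : ℝ × ℝ × ℝ => (σ * q.1, q.2.1, q.2.2)) (x, y, s) := by fun_prop
      exact (ContinuousAt.comp (f := fun q : ℝ × ℝ × ℝ => (σ * q.1, q.2.1, q.2.2)) 
        (x := (x, y, s)) h4 h5).continuousWithinAt)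
    (by
      intro x hx y hy s hs
      have := hsol.pde (x := σ * x) (y := y) (t := s) (by linarith [habs x hx])
        ⟨hy.1, by linarith [hy.2]⟩ (htI s hs)
      simp only [gradNorm] at this
      simp only [mul_pow, hσ, one_mul]
      exact this)
    (fun x hx s hs => hsol.bc (by linarith [habs x hx]) (htI s hs))
    (by
      intro y hy s hs
      simp only [mul_zero]
      rw [pdx_zero_axis p L T hL u hsol hmon y s ⟨hy.1, by linarith [hy.2]⟩ (htI s hs), mul_zero])
    (by
      intro x hx s hs
      have h1 := hM1 (σ * x, L/2, s) ⟨abs_le.1 (habs x hx), rfl, hs.1, hs.2.trans ht.2.le⟩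
      simp only [Real.norm_eq_abs] at h1
      have := (abs_le.1 h1).1
      have := le_abs_self M1
      linarith)
    (by
      intro x hx y hy
      have h1 := hM2 (σ * x, y, T/2) ⟨abs_le.1 (habs x hx), hy, rfl⟩
      simp only [Real.norm_eq_abs] at h1
      have := (abs_le.1 h1).1
      have := le_abs_self M2
      linarith)
    (fun y hy s hs => hbd y hy s ⟨hs.1, by linarith [hs.2, ht.2]⟩)
  rcases hx.2.eq_or_lt with h | h
  · have := hbd y hy t ht
    rw [← h] at this
    linarith
  · have htt : t ∈ Icc (T/2) t := ⟨ht.1, le_rfl⟩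
    have hd : HasDerivAt (fun r => u (σ * r) y t + K / 2 * r ^ 2) (σ * pdx u (σ * x) y t + K * x) x :=
      ((hfx x hx y hy t htt).add ((hasDerivAt_pow 2 x).const_mul (K / 2))).congr_deriv
        (by norm_num; ring)
    have := fd_right _ x (L/2) _ h (fun z hz => by
      have := hmono z x y t hx.1 hz.1 hz.2 hy htt
      linarith) hd
    linarith

/-- Proposition 2.2 (iv): under the monotonicity condition `x·u_x ≤ 0`,
one has `|u_x| ≤ C|x|` on `Q̃ = (ω̄' × [T/2,T]) \ {(0,0,T)}`. -/
theorem ux_linear_bound (p L T : ℝ) (hp : 2 < p) (hL : 0 < L) (hT : 0 < T)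
    (u : ℝ → ℝ → ℝ → ℝ)
    (hsol : ClassicalSolution p L T u) (hgbu : IsolatedGBU L T u)
    (hext : ExtC21 L T u) (hmon : MonCond L T u) :
    ∃ C : ℝ, 0 < C ∧ ∀ x y t : ℝ, |x| ≤ L/2 → y ∈ Icc (0:ℝ) (L/2) →
      t ∈ Icc (T/2) T → ¬(x = 0 ∧ y = 0 ∧ t = T) → |pdx u x y t| ≤ C * |x| := by
  obtain ⟨K1, hK1, h1⟩ := side p L T hp hL hT u hsol hext hmon 1 (by norm_num)
  obtain ⟨K2, hK2, h2⟩ := side p L T hp hL hT u hsol hext hmon (-1) (by norm_num)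
  have main : ∀ x y t : ℝ, |x| ≤ L/2 → y ∈ Icc (0:ℝ) (L/2) → t ∈ Ico (T/2) T →
      |pdx u x y t| ≤ (K1 + K2) * |x| := by
    intro x y t hx hy ht
    have htI : t ∈ Ioo 0 T := ⟨by linarith [ht.1], ht.2⟩
    have hxL : |x| < L := by linarith
    have hnn : 0 ≤ (K1 + K2) * |x| := by positivity
    rcases hy.1.eq_or_lt with h | hy0
    · rw [← h, pdx_zero_bdry p L T u hsol x t hxL htI, abs_zero]
      exact hnn
    · have hyL : y ∈ Ioo 0 L := ⟨hy0, by linarith [hy.2]⟩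
      have hm := hmon hxL hyL htI
      rcases lt_trichotomy x 0 with h | h | h
      · have ha : |x| = -x := abs_of_neg h
        have h3 := h2 (-x) ⟨by linarith, by linarith⟩ y hy t ht
        rw [show (-1:ℝ) * -x = x by ring] at h3
        have h4 : 0 ≤ pdx u x y t := by
          by_contra h'
          push Not at h'
          linarith [mul_pos_of_neg_of_neg h h']
        rw [abs_of_nonneg h4, ha]
        nlinarith
      · rw [h, pdx_zero_axis p L T hL u hsol hmon y t hyL htI]
        simp
      · have ha : |x| = x := abs_of_pos h
        have h3 := h1 x ⟨h.le, by linarith⟩ y hy t ht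
        rw [one_mul, one_mul] at h3
        have h4 : pdx u x y t ≤ 0 := by
          by_contra h'
          push Not at h'
          linarith [mul_pos h h']
        rw [abs_of_nonpos h4, ha]
        nlinarith
  refine ⟨K1 + K2, by positivity, ?_⟩
  intro x y t hx hy ht hne
  rcases ht.2.eq_or_lt with h | h
  · have hc := (hext hx hy ht hne).2.2.2.2.2.2.2.1
    have hc2 : ContinuousAt (fun s => pdx u x y s) t :=
      ContinuousAt.comp (f := fun s : ℝ => (x, y, s)) (x := t) hc (by fun_prop)
    refine le_of_tendsto (hc2.abs.tendsto.mono_left (nhdsWithin_le_nhds (s := Iio t))) ?_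
    have : T / 2 < t := by linarith
    filter_upwards [Ioo_mem_nhdsLT this] with s hs
    exact main x y s hx hy ⟨hs.1.le, h ▸ hs.2⟩
  · exact main x y t hx hy ⟨ht.1, h⟩
end
end
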